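/- Transformation identity (generalizing Langer–Schlosser–Warnaar): for m, r, k ∈ ℤ_{≥0} define T_k(x; y; z), for x, z ∈ ℂ^m and y ∈ ℂ^r, as the sum over pairs (μ, P) with μ ∈ ℤ_{≥0}^m, P ⊆ {1,…,r}, |μ|+|P| = k, of ∏_{i∈P, j∈P^c} ([y_i−y_j−δ][y_i−y_j+δ−κ])/([y_i−y_j][y_i−y_j−κ]) · ∏_{i,j=1}^m ( [x_i−x_j+δ]_{μ_i−μ_j}/[x_i−x_j+κ; δ]_{μ_i−μ_j} · ([x_i−x_j+κ; δ]_{μ_i} [x_i+z_j]_{μ_i})/([x_i−x_j+δ]_{μ_i} [x_i+z_j+δ−κ]_{μ_i}) ) · ∏_{i=1}^m ( ∏_{j∈P} ([z_i+y_j][x_i−y_j+(μ_i−1)δ+κ])/([z_i+y_j+δ−κ][x_i−y_j+μ_iδ]) · ∏_{j∈P^c} ([x_i−y_j−δ][x_i−y_j+μ_iδ−κ])/([x_i−y_j−κ][x_i−y_j+(μ_i−1)δ]) ). Then for all x, z ∈ ℂ^m and y ∈ ℂ^r at which all bracket values occurring in denominators on either side are nonzero, T_k(x; y; z) = T_k(z;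 ŷ; x), where ŷ_j := −y_j − δ for 1 ≤ j ≤ r. -/

import Mathlib

open Finset

/-- Shifted factorial `[x; a]_k` for `k ∈ ℤ`:
`[x; a]_k = [x][x+a]⋯[x+(k-1)a]` for `k ≥ 0` and `[x; a]_{-k} = 1/[x-ka; a]_k`. -/
noncomputable def sfac (br : ℂ → ℂ) (a x : ℂ) (k : ℤ) : ℂ :=
  if 0 ≤ k then ∏ i ∈ Finset.range k.toNat, br (x + (i : ℂ) * a)
  else (∏ i ∈ Finset.range (-k).toNat, br (x + ((k : ℂ) + (i : ℂ)) * a))⁻¹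

/-- The summand of `T_k(x; y; z)`. -/
noncomputable def Tterm (br : ℂ → ℂ) (δ κ : ℂ) {m r : ℕ} (μ : Fin m → ℕ)
    (P : Finset (Fin r)) (x : Fin m → ℂ) (y : Fin r → ℂ) (z : Fin m → ℂ) : ℂ :=
  (∏ i ∈ P, ∏ j ∈ Pᶜ,
      (br (y i - y j - δ) * br (y i - y j + δ - κ)) / (br (y i - y j) * br (y i - y j - κ)))
    * (∏ i : Fin m, ∏ j : Fin m,
        (sfac br δ (x i - x j + δ) ((μ i : ℤ) - (μ j : ℤ))
            / sfac br δ (x i - x j + κ) ((μ i : ℤ) - (μ j : ℤ)))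
          * ((sfac br δ (x i - x j + κ) (μ i : ℤ) * sfac br δ (x i + z j) (μ i : ℤ))
              / (sfac br δ (x i - x j + δ) (μ i : ℤ)
                * sfac br δ (x i + z j + δ - κ) (μ i : ℤ))))
    * ∏ i : Fin m,
        ((∏ j ∈ P,
            (br (z i + y j) * br (x i - y j + ((μ i : ℂ) - 1) * δ + κ))
              / (br (z i + y j + δ - κ) * br (x i - y j + (μ i : ℂ) * δ)))
          * ∏ j ∈ Pᶜ,
            (br (x i - y j - δ) * br (x i - y j + (μ i : ℂ) * δ - κ))
              / (br (x i - y j - κ) * br (x i - y j + ((μ i : ℂ) - 1) * δ)))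

/-- Index set: pairs `(μ, P)` with `μ ∈ ℤ_{≥0}^m`, `P ⊆ {1,…,r}`, `|μ|+|P| = k`. -/
def TIdx (m r k : ℕ) : Finset ((Fin m → ℕ) × Finset (Fin r)) :=
  ((Fintype.piFinset fun _ : Fin m => Finset.range (k + 1)) ×ˢ
      (Finset.univ : Finset (Finset (Fin r)))).filter
    fun p => (∑ i, p.1 i) + p.2.card = k

/-- The sum `T_k(x; y; z)`. -/
noncomputable def Tsum (br : ℂ → ℂ) (δ κ : ℂ) (m r k : ℕ)
    (x : Fin m → ℂ) (y : Fin r → ℂ) (z : Fin m → ℂ) : ℂ :=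
  ∑ p ∈ TIdx m r k, Tterm br δ κ p.1 p.2 x y z

/-- Nonvanishing of all bracket values occurring in denominators of a term of `T_k`. -/
def TDenomNZ (br : ℂ → ℂ) (δ κ : ℂ) {m r : ℕ} (μ : Fin m → ℕ)
    (P : Finset (Fin r)) (x : Fin m → ℂ) (y : Fin r → ℂ) (z : Fin m → ℂ) : Prop :=
  (∀ i ∈ P, ∀ j ∈ Pᶜ, br (y i - y j) ≠ 0 ∧ br (y i - y j - κ) ≠ 0)
    ∧ (∀ i j : Fin m,
        (if (0 : ℤ) ≤ (μ i : ℤ) - (μ j : ℤ) then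
            sfac br δ (x i - x j + κ) ((μ i : ℤ) - (μ j : ℤ)) ≠ 0
          else sfac br δ (x i - x j + δ) ((μ i : ℤ) - (μ j : ℤ)) ≠ 0)
          ∧ sfac br δ (x i - x j + δ) (μ i : ℤ) ≠ 0
          ∧ sfac br δ (x i + z j + δ - κ) (μ i : ℤ) ≠ 0)
    ∧ (∀ i : Fin m, ∀ j ∈ P,
        br (z i + y j + δ - κ) ≠ 0 ∧ br (x i - y j + (μ i : ℂ) * δ) ≠ 0)
    ∧ (∀ i : Fin m, ∀ j ∈ Pᶜ,
        br (x i - y j - κ) ≠ 0 ∧ br (x i - y j + ((μ i : ℂ) - 1) * δ) ≠ 0)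

/-- The hypotheses on the bracket function: odd, entire, not identically zero, and subject to the
three-term relation. -/
structure IsBracket (br : ℂ → ℂ) : Prop where
  odd : ∀ z : ℂ, br (-z) = -br z
  entire : Differentiable ℂ br
  ne_zero : br ≠ 0
  three_term : ∀ a b c d : ℂ,
      br (a + b) * br (a - b) * br (c + d) * br (c - d)
        + br (a + d) * br (a - d) * br (b + c) * br (b - c)
        = br (a + c) * br (a - c) * br (b + d) * br (b - d)

namespace IsBracket

variable {br : ℂ → ℂ} (hb : IsBracket br)
include hb

lemma map_zero : br 0 = 0 := by
  have h := hb.odd 0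
  rw [neg_zero] at h
  linear_combination h / 2

lemma map_sub_comm (a b : ℂ) : br (a - b) = -br (b - a) := by
  rw [← hb.odd, neg_sub]

lemma continuous : Continuous br := hb.entire.continuous

lemma isOpen_ne : IsOpen {u : ℂ | br u ≠ 0} := isOpen_ne_fun hb.continuous continuous_const

lemma dense_ne : Dense {u : ℂ | br u ≠ 0} := by
  rw [dense_iff_inter_open]
  intro U hU hne
  by_contra hcon
  obtain ⟨u₀, hu₀⟩ := hne
  have hzero : ∀ u ∈ U, br u = 0 := fun u hu => by
    by_contra h
    exact hcon ⟨u, hu, h⟩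
  have hev : br =ᶠ[nhds u₀] 0 := Filter.eventually_of_mem (hU.mem_nhds hu₀) hzero
  have han : AnalyticOnNhd ℂ br Set.univ := fun u _ => hb.entire.analyticAt u
  refine hb.ne_zero (funext fun u => ?_)
  exact han.eqOn_zero_of_preconnected_of_eventuallyEq_zero isPreconnected_univ
    (Set.mem_univ u₀) hev (Set.mem_univ u)

/-- Splitting `[z+a][z+b]` along two points `p`, `q`. -/
lemma split_pair (z a b p q : ℂ) :
    br (z + a) * br (z + b) * (br (p - q) * br (p + q + a + b)) =
      br (z - q) * br (z + (q + a + b)) * (br (p + a) * br (p + b))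
        - br (z - p) * br (z + (p + a + b)) * (br (q + a) * br (q + b)) := by
  have h := hb.three_term (z + (a + b) / 2) ((a - b) / 2) (p + (a + b) / 2) (q + (a + b) / 2)
  have e1 : z + (a + b) / 2 + (a - b) / 2 = z + a := by ring
  have e2 : z + (a + b) / 2 - (a - b) / 2 = z + b := by ring
  have e3 : p + (a + b) / 2 + (q + (a + b) / 2) = p + q + a + b := by ring
  have e4 : p + (a + b) / 2 - (q + (a + b) / 2) = p - q := by ring
  have e5 : z + (a + b) / 2 + (q + (a + b) / 2) = z + (q + a + b) := by ring
  have e6 : z + (a + b) / 2 - (q + (a + b) / 2) = z - q := by ring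
  have e7 : (a - b) / 2 + (p + (a + b) / 2) = p + a := by ring
  have e8 : (a - b) / 2 - (p + (a + b) / 2) = -(p + b) := by ring
  have e9 : z + (a + b) / 2 + (p + (a + b) / 2) = z + (p + a + b) := by ring
  have e10 : z + (a + b) / 2 - (p + (a + b) / 2) = z - p := by ring
  have e11 : (a - b) / 2 + (q + (a + b) / 2) = q + a := by ring
  have e12 : (a - b) / 2 - (q + (a + b) / 2) = -(q + b) := by ring
  rw [e1, e2, e3, e4, e5, e6, e7, e8, e9, e10, e11, e12, hb.odd, hb.odd] at h
  linear_combination h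

end IsBracket

/-- The product `∏ [z+a]` over a list of shifts. -/
noncomputable def thetaProd (br : ℂ → ℂ) (A : List ℂ) (z : ℂ) : ℂ :=
  (A.map fun a => br (z + a)).prod

/-- The Lagrange basis function for the node `b j`. -/
noncomputable def lagrangeTheta (br : ℂ → ℂ) {ι : Type*} [DecidableEq ι] (b : ι → ℂ)
    (J : Finset ι) (σ : ℂ) (j : ι) (z : ℂ) : ℂ :=
  br (z - b j + σ) * ∏ i ∈ J.erase j, (br (z - b i) / br (b j - b i))

namespace IsBracket

variable {br : ℂ → ℂ} (hb : IsBracket br)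
include hb

/-- Interpolation for a product having a root at one of the nodes. -/
lemma interpolation_of_root {ι : Type*} [DecidableEq ι] (b : ι → ℂ) (J : Finset ι) (q : ι)
    (hq : q ∈ J) (hJ : ∀ i ∈ J, ∀ j ∈ J, i ≠ j → br (b i - b j) ≠ 0) (g : ℂ → ℂ) (σ z : ℂ)
    (hg : g z * br σ = ∑ j ∈ J.erase q, g (b j) * lagrangeTheta br b (J.erase q) σ j z) :
    br (z - b q) * g z * br σ =
      ∑ j ∈ J, br (b j - b q) * g (b j) * lagrangeTheta br b J σ j z := by
  rw [← Finset.add_sum_erase _ _ hq, sub_self, hb.map_zero, zero_mul, zero_mul, zero_add,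
    mul_assoc, hg, Finset.mul_sum]
  refine Finset.sum_congr rfl fun j hj => ?_
  have hjq := Finset.ne_of_mem_erase hj
  have hne := hJ j (Finset.mem_of_mem_erase hj) q hq hjq
  have hmem : q ∈ J.erase j := Finset.mem_erase.2 ⟨hjq.symm, hq⟩
  rw [lagrangeTheta, lagrangeTheta, ← Finset.mul_prod_erase _ _ hmem, Finset.erase_right_comm]
  field_simp

/-- Lagrange interpolation for products of brackets. -/
lemma interpolation {ι : Type*} [DecidableEq ι] (b : ι → ℂ) (n : ℕ) :
    ∀ (A : List ℂ) (J : Finset ι), A.length = n → J.card = n →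
      (∀ i ∈ J, ∀ j ∈ J, i ≠ j → br (b i - b j) ≠ 0) →
      br (A.sum + ∑ j ∈ J, b j) ≠ 0 → ∀ z,
      thetaProd br A z * br (A.sum + ∑ j ∈ J, b j) =
        ∑ j ∈ J, thetaProd br A (b j) * lagrangeTheta br b J (A.sum + ∑ j ∈ J, b j) j z := by
  induction n with
  | zero =>
    intro A J hA hJ _ h0
    rw [List.length_eq_zero_iff] at hA
    rw [Finset.card_eq_zero] at hJ
    subst hA hJ
    simp [hb.map_zero] at h0
  | succ n ih =>
    intro A J hA hJ hdist h0 z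
    have key : ∀ (a₁ a₂ : ℂ) (R : List ℂ) (p q : ι), p ∈ J → q ∈ J → p ≠ q →
        R.length + 1 = n → br (a₁ + a₂ + R.sum + ∑ j ∈ J, b j) ≠ 0 →
        br (b p + b q + a₁ + a₂) ≠ 0 →
        thetaProd br (a₁ :: a₂ :: R) z * br (a₁ + a₂ + R.sum + ∑ j ∈ J, b j) =
          ∑ j ∈ J, thetaProd br (a₁ :: a₂ :: R) (b j) *
            lagrangeTheta br b J (a₁ + a₂ + R.sum + ∑ j ∈ J, b j) j z := by
      intro a₁ a₂ R p q hp hq hpq hR h0 hgen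
      set σ := a₁ + a₂ + R.sum + ∑ j ∈ J, b j with hσ
      have sub : ∀ q ∈ J, br (z - b q) * thetaProd br ((b q + a₁ + a₂) :: R) z * br σ =
          ∑ j ∈ J, br (b j - b q) * thetaProd br ((b q + a₁ + a₂) :: R) (b j) *
            lagrangeTheta br b J σ j z := by
        intro q hq
        apply hb.interpolation_of_root b J q hq hdist
        have hs : ((b q + a₁ + a₂) :: R).sum + ∑ j ∈ J.erase q, b j = σ := by
          rw [hσ, ← Finset.add_sum_erase _ _ hq, List.sum_cons]; ring
        have := ih ((b q + a₁ + a₂) :: R) (J.erase q) (by simpa using hR)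
          (by rw [Finset.card_erase_of_mem hq, hJ]; rfl)
          (fun i hi j hj => hdist i (Finset.mem_of_mem_erase hi) j (Finset.mem_of_mem_erase hj))
          (by rwa [hs]) z
        rwa [hs] at this
      have hne : br (b p - b q) * br (b p + b q + a₁ + a₂) ≠ 0 :=
        mul_ne_zero (hdist p hp q hq hpq) hgen
      have expand : ∀ w, thetaProd br (a₁ :: a₂ :: R) w *
          (br (b p - b q) * br (b p + b q + a₁ + a₂)) =
          br (b p + a₁) * br (b p + a₂) *
              (br (w - b q) * thetaProd br ((b q + a₁ + a₂) :: R) w) -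
            br (b q + a₁) * br (b q + a₂) *
              (br (w - b p) * thetaProd br ((b p + a₁ + a₂) :: R) w) := by
        intro w
        have := hb.split_pair w a₁ a₂ (b p) (b q)
        simp only [thetaProd, List.map_cons, List.prod_cons]
        linear_combination (R.map fun a => br (w + a)).prod * this
      apply mul_right_cancel₀ hne
      rw [mul_right_comm, expand, Finset.sum_mul]
      calc _ = br (b p + a₁) * br (b p + a₂) *
                (br (z - b q) * thetaProd br ((b q + a₁ + a₂) :: R) z * br σ) -
              br (b q + a₁) * br (b q + a₂) *
                (br (z - b p) * thetaProd br ((b p + a₁ + a₂) :: R) z * br σ) := by ring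
        _ = _ := by
          rw [sub q hq, sub p hp, Finset.mul_sum, Finset.mul_sum, ← Finset.sum_sub_distrib]
          refine Finset.sum_congr rfl fun j _ => ?_
          linear_combination -lagrangeTheta br b J σ j z * expand (b j)
    match A, hA with
    | [a], hA =>
      obtain ⟨p, rfl⟩ := Finset.card_eq_one.1 (hJ.trans hA.symm)
      simp [thetaProd, lagrangeTheta, mul_comm, add_comm]
    | a₁ :: a₂ :: R, hA =>
      obtain ⟨p, hp, q, hq, hpq⟩ := Finset.one_lt_card.1 (by
        rw [hJ, ← hA]; simp : 1 < J.card)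
      have hR : R.length + 1 = n := by simpa using hA
      simp only [List.sum_cons, ← add_assoc] at h0 ⊢
      match R, hR with
      | [], hR =>
        apply key a₁ a₂ [] p q hp hq hpq hR h0
        have hJ' : J = {p, q} := by
          symm
          apply Finset.eq_of_subset_of_card_le
          · intro i hi
            rcases Finset.mem_insert.1 hi with rfl | hi
            · exact hp
            · rwa [Finset.mem_singleton.1 hi]
          · rw [Finset.card_pair hpq, hJ, ← hR]; simp
        rw [hJ', Finset.sum_pair hpq] at h0
        convert h0 using 2
        simp; ring
      | a₃ :: R, hR =>
        have hσ : ∀ t : ℂ, a₁ + t + a₂ + ((a₃ - t) :: R).sum + ∑ j ∈ J, b j =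
            a₁ + a₂ + (a₃ :: R).sum + ∑ j ∈ J, b j := fun t => by
          simp only [List.sum_cons]; ring
        have hd : Dense {t : ℂ | br (b p + b q + a₁ + a₂ + t) ≠ 0} :=
          hb.dense_ne.preimage (Homeomorph.addLeft (b p + b q + a₁ + a₂)).isOpenMap
        have hc : ∀ w, Continuous fun t => thetaProd br ((a₁ + t) :: a₂ :: (a₃ - t) :: R) w := by
          intro w
          have := hb.continuous
          simp only [thetaProd, List.map_cons, List.prod_cons]
          fun_prop
        have := Continuous.ext_on hd (f := fun t =>
            thetaProd br ((a₁ + t) :: a₂ :: (a₃ - t) :: R) z *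
              br (a₁ + a₂ + (a₃ :: R).sum + ∑ j ∈ J, b j))
          (g := fun t => ∑ j ∈ J, thetaProd br ((a₁ + t) :: a₂ :: (a₃ - t) :: R) (b j) *
            lagrangeTheta br b J (a₁ + a₂ + (a₃ :: R).sum + ∑ j ∈ J, b j) j z)
          ((hc z).mul continuous_const)
          (continuous_finsetSum _ fun j _ => (hc (b j)).mul continuous_const)
          (fun t ht => by
            have := key (a₁ + t) a₂ ((a₃ - t) :: R) p q hp hq hpq hR (by rw [hσ]; exact h0)
              (by
                have ht : br (b p + b q + a₁ + a₂ + t) ≠ 0 := ht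
                convert ht using 2
                ring)
            rwa [hσ] at this)
        simpa using congr_fun this 0

end IsBracket

/-- The span of the products of `d` brackets whose shifts add up to `s`. -/
noncomputable def thetaSpace (br : ℂ → ℂ) (d : ℕ) (s : ℂ) : Submodule ℂ (ℂ → ℂ) :=
  Submodule.span ℂ {f | ∃ A : List ℂ, A.length = d ∧ A.sum = s ∧ f = thetaProd br A}

section thetaSpace

variable {br : ℂ → ℂ}

lemma thetaProd_mem_thetaSpace (A : List ℂ) : thetaProd br A ∈ thetaSpace br A.length A.sum :=
  Submodule.subset_span ⟨A, rfl, rfl, rfl⟩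

lemma one_mem_thetaSpace : (1 : ℂ → ℂ) ∈ thetaSpace br 0 0 :=
  thetaProd_mem_thetaSpace (br := br) []

lemma bracket_mem_thetaSpace (a : ℂ) : (fun z => br (z + a)) ∈ thetaSpace br 1 a := by
  have := thetaProd_mem_thetaSpace (br := br) [a]
  have e : thetaProd br [a] = fun z => br (z + a) := by ext z; simp [thetaProd]
  simpa [e] using this

lemma mul_mem_thetaSpace {d e : ℕ} {s t : ℂ} {f g : ℂ → ℂ} (hf : f ∈ thetaSpace br d s)
    (hg : g ∈ thetaSpace br e t) : f * g ∈ thetaSpace br (d + e) (s + t) := by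
  induction hf using Submodule.span_induction with
  | zero => simp
  | add u v _ _ hu hv => rw [add_mul]; exact add_mem hu hv
  | smul c u _ hu => rw [smul_mul_assoc]; exact Submodule.smul_mem _ _ hu
  | mem u hu =>
    obtain ⟨A, rfl, rfl, rfl⟩ := hu
    induction hg using Submodule.span_induction with
    | zero => simp
    | add u v _ _ hu hv => rw [mul_add]; exact add_mem hu hv
    | smul c u _ hu => rw [mul_smul_comm]; exact Submodule.smul_mem _ _ hu
    | mem v hv =>
      obtain ⟨B, rfl, rfl, rfl⟩ := hv
      rw [← List.length_append, ← List.sum_append]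
      convert thetaProd_mem_thetaSpace (br := br) (A ++ B) using 1
      ext z
      simp [thetaProd]

lemma prod_mem_thetaSpace {ι : Type*} (S : Finset ι) (d : ι → ℕ) (s : ι → ℂ) (f : ι → ℂ → ℂ)
    (h : ∀ i ∈ S, f i ∈ thetaSpace br (d i) (s i)) :
    (∏ i ∈ S, f i) ∈ thetaSpace br (∑ i ∈ S, d i) (∑ i ∈ S, s i) := by
  classical
  induction S using Finset.induction_on with
  | empty => simpa using one_mem_thetaSpace
  | insert a S ha ih =>
    rw [Finset.prod_insert ha, Finset.sum_insert ha, Finset.sum_insert ha]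
    exact mul_mem_thetaSpace (h a (Finset.mem_insert_self a S))
      (ih fun i hi => h i (Finset.mem_insert_of_mem hi))

/-- An element of a space of degree `d` with more than `d` independent zeros vanishes. -/
lemma IsBracket.eq_zero_of_mem_thetaSpace (hb : IsBracket br) {d : ℕ} {s : ℂ} {F : ℂ → ℂ}
    (hF : F ∈ thetaSpace br d s) {ι : Type*} (J : Finset ι) (b : ι → ℂ) (hJ : d < J.card)
    (hdist : ∀ i ∈ J, ∀ j ∈ J, i ≠ j → br (b i - b j) ≠ 0) (hz : ∀ i ∈ J, F (b i) = 0) :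
    F = 0 := by
  classical
  obtain ⟨J', hJ', hcard⟩ := Finset.exists_subset_card_eq (Nat.succ_le_of_lt hJ)
  replace hdist : ∀ i ∈ J', ∀ j ∈ J', i ≠ j → br (b i - b j) ≠ 0 :=
    fun i hi j hj => hdist i (hJ' hi) j (hJ' hj)
  replace hz : ∀ i ∈ J', F (b i) = 0 := fun i hi => hz i (hJ' hi)
  ext z
  obtain ⟨a, ha₁, ha₂⟩ : ∃ a : ℂ, br (z + a) ≠ 0 ∧ br (s + ∑ j ∈ J', b j + a) ≠ 0 := by
    have h₁ : Dense {t : ℂ | br (z + t) ≠ 0} :=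
      hb.dense_ne.preimage (Homeomorph.addLeft z).isOpenMap
    have h₂ : Dense {t : ℂ | br (s + ∑ j ∈ J', b j + t) ≠ 0} :=
      hb.dense_ne.preimage (Homeomorph.addLeft (s + ∑ j ∈ J', b j)).isOpenMap
    have ho : IsOpen {t : ℂ | br (z + t) ≠ 0} :=
      hb.isOpen_ne.preimage (Homeomorph.addLeft z).continuous
    exact (h₁.inter_of_isOpen_left h₂ ho).nonempty
  have main : F z * br (z + a) * br (s + ∑ j ∈ J', b j + a) =
      ∑ j ∈ J', F (b j) * br (b j + a) *
        lagrangeTheta br b J' (s + ∑ j ∈ J', b j + a) j z := by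
    clear hz
    induction hF using Submodule.span_induction with
    | zero => simp
    | add u v _ _ hu hv => simp only [Pi.add_apply, add_mul, hu, hv, Finset.sum_add_distrib]
    | smul c u _ hu => simp only [Pi.smul_apply, smul_eq_mul, mul_assoc, ← Finset.mul_sum] at hu ⊢
                       rw [hu]
    | mem u hu =>
      obtain ⟨A, rfl, rfl, rfl⟩ := hu
      have hs : (a :: A).sum + ∑ j ∈ J', b j = A.sum + ∑ j ∈ J', b j + a := by
        rw [List.sum_cons]; ring
      have := hb.interpolation b _ (a :: A) J' (by simp) hcard hdist (by rwa [hs]) z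
      rw [hs] at this
      simpa [thetaProd, mul_comm] using this
  have hsum : ∑ j ∈ J', F (b j) * br (b j + a) *
      lagrangeTheta br b J' (s + ∑ j ∈ J', b j + a) j z = 0 :=
    Finset.sum_eq_zero fun j hj => by rw [hz j hj, zero_mul, zero_mul]
  rw [hsum, mul_eq_zero, mul_eq_zero] at main
  simpa only [ha₁, ha₂, or_false, Pi.zero_apply] using main

end thetaSpace

/-- The kernel of the subset sums. -/
noncomputable def kern (br : ℂ → ℂ) (δ κ u : ℂ) : ℂ :=
  br (u - δ) * br (u + δ - κ) / (br u * br (u - κ))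

/-- The sum over all subsets `I ⊆ S` of `∏_{i ∈ I, j ∈ S \ I} K i j`, weighted by `c |I|`. -/
noncomputable def splitSum {ι : Type*} [DecidableEq ι] (S : Finset ι) (c : ℕ → ℂ)
    (K : ι → ι → ℂ) : ℂ :=
  ∑ I ∈ S.powerset, c I.card * ∏ i ∈ I, ∏ j ∈ S \ I, K i j

section splitSum

variable {ι : Type*} [DecidableEq ι]

lemma splitSum_congr {S : Finset ι} {c : ℕ → ℂ} {K L : ι → ι → ℂ}
    (h : ∀ i ∈ S, ∀ j ∈ S, i ≠ j → K i j = L i j) : splitSum S c K = splitSum S c L := by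
  refine Finset.sum_congr rfl fun I hI => ?_
  congr 1
  refine Finset.prod_congr rfl fun i hi => Finset.prod_congr rfl fun j hj => ?_
  have hj := Finset.mem_sdiff.1 hj
  exact h i (Finset.mem_powerset.1 hI hi) j hj.1 fun e => hj.2 (e ▸ hi)

lemma prod_prod_sdiff_insert_of_subset {a : ι} {S I : Finset ι} (ha : a ∉ S) (hI : I ⊆ S)
    (K : ι → ι → ℂ) :
    ∏ i ∈ I, ∏ j ∈ insert a S \ I, K i j =
      (∏ i ∈ I, ∏ j ∈ S \ I, K i j) * ∏ i ∈ I, K i a := by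
  have haI : a ∉ I := fun h => ha (hI h)
  rw [Finset.insert_sdiff_of_notMem _ haI, ← Finset.prod_mul_distrib]
  refine Finset.prod_congr rfl fun i _ => ?_
  rw [Finset.prod_insert (fun h => ha (Finset.mem_sdiff.1 h).1), mul_comm]

lemma insert_sdiff_insert_self {a : ι} {S I : Finset ι} (ha : a ∉ S) :
    insert a S \ insert a I = S \ I := by
  ext i
  by_cases h : i = a
  · subst h; simp [ha]
  · simp [h]

lemma prod_prod_sdiff_insert_insert {a : ι} {S I : Finset ι} (ha : a ∉ S) (hI : I ⊆ S)
    (K : ι → ι → ℂ) :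
    ∏ i ∈ insert a I, ∏ j ∈ insert a S \ insert a I, K i j =
      (∏ i ∈ I, ∏ j ∈ S \ I, K i j) * ∏ j ∈ S \ I, K a j := by
  rw [insert_sdiff_insert_self ha, Finset.prod_insert (fun h => ha (hI h)), mul_comm]

lemma splitSum_insert {a : ι} {S : Finset ι} (ha : a ∉ S) (c : ℕ → ℂ) (K : ι → ι → ℂ) :
    splitSum (insert a S) c K =
      ∑ I ∈ S.powerset, (∏ i ∈ I, ∏ j ∈ S \ I, K i j) *
        (c I.card * ∏ i ∈ I, K i a + c (I.card + 1) * ∏ j ∈ S \ I, K a j) := by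
  rw [splitSum, Finset.sum_powerset_insert ha, ← Finset.sum_add_distrib]
  refine Finset.sum_congr rfl fun I hI => ?_
  have hI := Finset.mem_powerset.1 hI
  rw [prod_prod_sdiff_insert_of_subset ha hI, prod_prod_sdiff_insert_insert ha hI,
    Finset.card_insert_of_notMem (fun h => ha (hI h))]
  ring

lemma prod_sdiff_mul_prod {S I : Finset ι} (hI : I ⊆ S) (f : ι → ℂ) :
    (∏ i ∈ S \ I, f i) * ∏ i ∈ I, f i = ∏ i ∈ S, f i :=
  Finset.prod_sdiff hI

/-- Subset sums are invariant under permutations of the index type. -/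
lemma splitSum_equiv (e : ι ≃ ι) {S : Finset ι} (hS : S.map e.toEmbedding = S) (c : ℕ → ℂ)
    (K : ι → ι → ℂ) : splitSum S c (fun i j => K (e i) (e j)) = splitSum S c K := by
  have hmem : ∀ i, e i ∈ S ↔ i ∈ S := fun i => by
    conv_lhs => rw [← hS]
    simp
  refine Finset.sum_equiv (Equiv.finsetCongr e) (fun I => ?_) fun I _ => ?_
  · simp only [Finset.mem_powerset, Equiv.finsetCongr_apply]
    conv_rhs => rw [← hS]
    exact Finset.map_subset_map.symm
  · have hsd : S \ I.map e.toEmbedding = (S \ I).map e.toEmbedding := by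
      rw [Finset.map_sdiff, hS]
    simp [hsd]

end splitSum

/-- The numerator of `kern` over the common denominator `kernDen`. -/
noncomputable def kernNum (br : ℂ → ℂ) (δ κ u : ℂ) : ℂ :=
  br (u + -δ) * br (u + (δ - κ)) * br (u + κ)

/-- The common denominator of `kern u` and `kern (-u)`. -/
noncomputable def kernDen (br : ℂ → ℂ) (κ u : ℂ) : ℂ :=
  br (u + 0) * br (u + -κ) * br (u + κ)

/-- The subset sum over `S` and one further point `z`, with denominators in `z` cleared. -/
noncomputable def clearedSum (br : ℂ → ℂ) (δ κ : ℂ) {ι : Type*} [DecidableEq ι] (S : Finset ι)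
    (c : ℕ → ℂ) (x : ι → ℂ) (z : ℂ) : ℂ :=
  ∑ I ∈ S.powerset, (∏ i ∈ I, ∏ j ∈ S \ I, kern br δ κ (x i - x j)) *
    (c I.card * ((∏ i ∈ I, kernNum br (-δ) (-κ) (z - x i)) * ∏ j ∈ S \ I, kernDen br κ (z - x j))
      + c (I.card + 1) *
        ((∏ j ∈ S \ I, kernNum br δ κ (z - x j)) * ∏ i ∈ I, kernDen br κ (z - x i)))

section kern

variable {br : ℂ → ℂ} (hb : IsBracket br) (δ κ : ℂ)
include hb

lemma kern_neg_neg (u : ℂ) : kern br (-δ) (-κ) u = kern br δ κ (-u) := by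
  have h1 : br (u - -δ) = -br (-u - δ) := by rw [← hb.odd]; ring_nf
  have h2 : br (u + -δ - -κ) = -br (-u + δ - κ) := by rw [← hb.odd]; ring_nf
  have h3 : br u = -br (-u) := by rw [← hb.odd]; ring_nf
  have h4 : br (u - -κ) = -br (-u - κ) := by rw [← hb.odd]; ring_nf
  rw [kern, kern, h1, h2, h3, h4]
  ring

lemma kern_sub_neg_neg (a b : ℂ) : kern br (-δ) (-κ) (a - b) = kern br δ κ (b - a) := by
  rw [kern_neg_neg hb, neg_sub]

omit hb in
lemma kernDen_neg (u : ℂ) : kernDen br (-κ) u = kernDen br κ u := by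
  rw [kernDen, kernDen, neg_neg]; ring

omit hb in
lemma kern_mul_kernDen {u : ℂ} (h0 : br u ≠ 0) (h1 : br (u - κ) ≠ 0) :
    kern br δ κ u * kernDen br κ u = kernNum br δ κ u := by
  rw [kern, kernDen, kernNum, add_zero, ← sub_eq_add_neg, ← sub_eq_add_neg,
    show u + (δ - κ) = u + δ - κ by ring]
  field_simp

lemma kern_mul_kernDen_neg {a b : ℂ} (h0 : br (b - a) ≠ 0) (h1 : br (b - a - κ) ≠ 0) :
    kern br δ κ (b - a) * kernDen br κ (a - b) = kernNum br (-δ) (-κ) (a - b) := by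
  rw [← kern_sub_neg_neg hb, ← kernDen_neg, kern_mul_kernDen]
  · rwa [hb.map_sub_comm, neg_ne_zero]
  · rwa [show a - b - -κ = -(b - a - κ) by ring, hb.odd, neg_ne_zero]

lemma kern_mul_kernDen_shift {a b : ℂ} (h0 : br (b - a) ≠ 0) (h1 : br (b - a - κ) ≠ 0) :
    kern br δ κ (b - a) * kernDen br κ (a + κ - b) = kernNum br δ κ (a + κ - b) := by
  have e1 : br (b - a - δ) = -br (a + κ - b + (δ - κ)) := by rw [← hb.odd]; ring_nf
  have e2 : br (b - a + δ - κ) = -br (a + κ - b + -δ) := by rw [← hb.odd]; ring_nf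
  have e3 : br (b - a) = -br (a + κ - b + -κ) := by rw [← hb.odd]; ring_nf
  have e4 : br (b - a - κ) = -br (a + κ - b + 0) := by rw [← hb.odd]; ring_nf
  rw [e3, neg_ne_zero] at h0
  rw [e4, neg_ne_zero] at h1
  rw [kern, kernDen, kernNum, e1, e2, e3, e4]
  field_simp

lemma kernDen_zero : kernDen br κ 0 = 0 := by simp [kernDen, hb.map_zero]

lemma kernDen_self : kernDen br κ κ = 0 := by simp [kernDen, hb.map_zero]

lemma kernNum_neg_neg_self : kernNum br (-δ) (-κ) κ = 0 := by simp [kernNum, hb.map_zero]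

lemma kernNum_neg_neg_zero : kernNum br (-δ) (-κ) 0 = -kernNum br δ κ 0 := by
  simp only [kernNum, zero_add, neg_neg]
  rw [show -δ - -κ = -(δ - κ) by ring, hb.odd, hb.odd, hb.odd]
  ring

variable {ι : Type*} [DecidableEq ι]

lemma clearedSum_eq {a : ι} {S : Finset ι} (ha : a ∉ S) (c : ℕ → ℂ) (x : ι → ℂ)
    (h : ∀ j ∈ S, br (x a - x j) ≠ 0 ∧ br (x a - x j - κ) ≠ 0 ∧ br (x j - x a - κ) ≠ 0) :
    clearedSum br δ κ S c x (x a) =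
      (∏ j ∈ S, kernDen br κ (x a - x j)) *
        splitSum (insert a S) c fun i j => kern br δ κ (x i - x j) := by
  rw [splitSum_insert ha, clearedSum, Finset.mul_sum]
  refine Finset.sum_congr rfl fun I hI => ?_
  have hI := Finset.mem_powerset.1 hI
  have h1 : ∏ i ∈ I, kernNum br (-δ) (-κ) (x a - x i) =
      (∏ i ∈ I, kern br δ κ (x i - x a)) * ∏ i ∈ I, kernDen br κ (x a - x i) := by
    rw [← Finset.prod_mul_distrib]
    refine Finset.prod_congr rfl fun i hi => (kern_mul_kernDen_neg hb δ κ ?_ (h i (hI hi)).2.2).symm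
    rw [hb.map_sub_comm, neg_ne_zero]
    exact (h i (hI hi)).1
  have h2 : ∏ j ∈ S \ I, kernNum br δ κ (x a - x j) =
      (∏ j ∈ S \ I, kern br δ κ (x a - x j)) * ∏ j ∈ S \ I, kernDen br κ (x a - x j) := by
    rw [← Finset.prod_mul_distrib]
    refine Finset.prod_congr rfl fun j hj => (kern_mul_kernDen δ κ ?_ ?_).symm
    · exact (h j (Finset.mem_sdiff.1 hj).1).1
    · exact (h j (Finset.mem_sdiff.1 hj).1).2.1
  rw [h1, h2, ← prod_sdiff_mul_prod hI]
  ring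

lemma clearedSum_node {b : ι} {S : Finset ι} (hbS : b ∉ S) (c : ℕ → ℂ) (x : ι → ℂ)
    (h : ∀ j ∈ S, br (x b - x j) ≠ 0 ∧ br (x b - x j - κ) ≠ 0 ∧ br (x j - x b - κ) ≠ 0) :
    clearedSum br δ κ (insert b S) c x (x b) = 0 := by
  rw [clearedSum, Finset.sum_powerset_insert hbS, ← Finset.sum_add_distrib]
  refine Finset.sum_eq_zero fun I hI => ?_
  have hI := Finset.mem_powerset.1 hI
  have hbI : b ∉ I := fun h => hbS (hI h)
  have hbSI : b ∉ S \ I := fun h => hbS (Finset.mem_sdiff.1 h).1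
  have h1 : ∏ i ∈ I, kernNum br (-δ) (-κ) (x b - x i) =
      (∏ i ∈ I, kern br δ κ (x i - x b)) * ∏ i ∈ I, kernDen br κ (x b - x i) := by
    rw [← Finset.prod_mul_distrib]
    refine Finset.prod_congr rfl fun i hi => (kern_mul_kernDen_neg hb δ κ ?_ (h i (hI hi)).2.2).symm
    rw [hb.map_sub_comm, neg_ne_zero]
    exact (h i (hI hi)).1
  have h2 : ∏ j ∈ S \ I, kernNum br δ κ (x b - x j) =
      (∏ j ∈ S \ I, kern br δ κ (x b - x j)) * ∏ j ∈ S \ I, kernDen br κ (x b - x j) := by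
    rw [← Finset.prod_mul_distrib]
    refine Finset.prod_congr rfl fun j hj => (kern_mul_kernDen δ κ ?_ ?_).symm
    · exact (h j (Finset.mem_sdiff.1 hj).1).1
    · exact (h j (Finset.mem_sdiff.1 hj).1).2.1
  rw [prod_prod_sdiff_insert_of_subset hbS hI, prod_prod_sdiff_insert_insert hbS hI,
    insert_sdiff_insert_self hbS, Finset.insert_sdiff_of_notMem _ hbI,
    Finset.card_insert_of_notMem hbI]
  simp only [Finset.prod_insert hbI, Finset.prod_insert hbSI, sub_self, kernDen_zero hb,
    kernNum_neg_neg_zero hb, h1, h2]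
  ring

lemma clearedSum_shifted_node {b : ι} {S : Finset ι} (hbS : b ∉ S) (c : ℕ → ℂ) (x : ι → ℂ)
    (h : ∀ j ∈ S, br (x j - x b) ≠ 0 ∧ br (x j - x b - κ) ≠ 0) :
    clearedSum br δ κ (insert b S) c x (x b + κ) =
      kernNum br δ κ κ * (∏ j ∈ S, kernNum br δ κ (x b + κ - x j)) *
        splitSum S (fun n => c (n + 1)) fun i j => kern br δ κ (x i - x j) := by
  rw [clearedSum, Finset.sum_powerset_insert hbS, ← Finset.sum_add_distrib, splitSum,
    Finset.mul_sum]
  refine Finset.sum_congr rfl fun I hI => ?_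
  have hI := Finset.mem_powerset.1 hI
  have hbI : b ∉ I := fun h => hbS (hI h)
  have hbSI : b ∉ S \ I := fun h => hbS (Finset.mem_sdiff.1 h).1
  have h1 : ∏ i ∈ I, kernNum br δ κ (x b + κ - x i) =
      (∏ i ∈ I, kern br δ κ (x i - x b)) * ∏ i ∈ I, kernDen br κ (x b + κ - x i) := by
    rw [← Finset.prod_mul_distrib]
    exact Finset.prod_congr rfl fun i hi =>
      (kern_mul_kernDen_shift hb δ κ (h i (hI hi)).1 (h i (hI hi)).2).symm
  rw [prod_prod_sdiff_insert_of_subset hbS hI,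
    insert_sdiff_insert_self hbS, Finset.insert_sdiff_of_notMem _ hbI,
    Finset.card_insert_of_notMem hbI, ← prod_sdiff_mul_prod hI, h1]
  simp only [Finset.prod_insert hbI, Finset.prod_insert hbSI, add_sub_cancel_left,
    kernDen_self hb, kernNum_neg_neg_self hb]
  ring

lemma clearedSum_neg_shifted_node {b : ι} {S : Finset ι} (hbS : b ∉ S) (c : ℕ → ℂ) (x : ι → ℂ)
    (h : ∀ j ∈ S, br (x j - x b) ≠ 0 ∧ br (x j - x b - κ) ≠ 0) :
    clearedSum br (-δ) (-κ) (insert b S) c x (x b + κ) =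
      kernNum br δ κ κ * (∏ j ∈ S, kernNum br δ κ (x b + κ - x j)) *
        splitSum S (fun n => c (n + 1)) fun i j => kern br (-δ) (-κ) (x i - x j) := by
  rw [clearedSum, Finset.sum_powerset_insert hbS, ← Finset.sum_add_distrib, splitSum,
    Finset.mul_sum]
  refine Finset.sum_congr rfl fun I hI => ?_
  have hI := Finset.mem_powerset.1 hI
  have hbI : b ∉ I := fun h => hbS (hI h)
  have hbSI : b ∉ S \ I := fun h => hbS (Finset.mem_sdiff.1 h).1
  have h1 : ∏ j ∈ S \ I, kernNum br δ κ (x b + κ - x j) =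
      (∏ j ∈ S \ I, kern br (-δ) (-κ) (x b - x j)) *
        ∏ j ∈ S \ I, kernDen br κ (x b + κ - x j) := by
    rw [← Finset.prod_mul_distrib]
    refine Finset.prod_congr rfl fun j hj => ?_
    have hj := h j (Finset.mem_sdiff.1 hj).1
    rw [kern_sub_neg_neg hb, kern_mul_kernDen_shift hb δ κ hj.1 hj.2]
  rw [prod_prod_sdiff_insert_insert hbS hI,
    insert_sdiff_insert_self hbS, Finset.insert_sdiff_of_notMem _ hbI,
    Finset.card_insert_of_notMem hbI, ← prod_sdiff_mul_prod hI, h1]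
  simp only [Finset.prod_insert hbI, Finset.prod_insert hbSI, add_sub_cancel_left,
    kernDen_neg, neg_neg, kernDen_self hb, kernNum_neg_neg_self hb]
  ring

end kern

/-- Genericity of a family of points, invariant under sign changes of its members. -/
def SignGeneric (br : ℂ → ℂ) (κ : ℂ) {ι : Type*} (S : Finset ι) (x : ι → ℂ) : Prop :=
  ∀ i ∈ S, ∀ j ∈ S, i ≠ j → ∀ n : ℤ, br (x i - x j + n * κ) ≠ 0 ∧ br (x i + x j + n * κ) ≠ 0

/-- Change the sign of the points in `T`. -/
def flipOn {ι : Type*} [DecidableEq ι] (T : Finset ι) (x : ι → ℂ) (i : ι) : ℂ :=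
  if i ∈ T then -x i else x i

/-- The defect of the duality of subset sums. -/
noncomputable def dualDefect (br : ℂ → ℂ) (δ κ : ℂ) {ι : Type*} [DecidableEq ι] (S : Finset ι)
    (c : ℕ → ℂ) (x : ι → ℂ) : ℂ :=
  splitSum S c (fun i j => kern br δ κ (x i - x j)) -
    splitSum S c fun i j => kern br (-δ) (-κ) (x i - x j)

section duality

variable {br : ℂ → ℂ} {ι : Type*} [DecidableEq ι]

lemma dualDefect_congr (δ κ : ℂ) {S : Finset ι} (c : ℕ → ℂ) {x x' : ι → ℂ}
    (h : ∀ i ∈ S, x i = x' i) : dualDefect br δ κ S c x = dualDefect br δ κ S c x' := by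
  rw [dualDefect, dualDefect]
  congr 1 <;> exact splitSum_congr fun i hi j hj _ => by rw [h i hi, h j hj]

lemma clearedSum_congr (δ κ : ℂ) {S : Finset ι} (c : ℕ → ℂ) {x x' : ι → ℂ}
    (h : ∀ i ∈ S, x i = x' i) (z : ℂ) :
    clearedSum br δ κ S c x z = clearedSum br δ κ S c x' z := by
  refine Finset.sum_congr rfl fun I hI => ?_
  have h1 : ∀ i ∈ I, x i = x' i := fun i hi => h i (Finset.mem_powerset.1 hI hi)
  have h2 : ∀ i ∈ S \ I, x i = x' i := fun i hi => h i (Finset.mem_sdiff.1 hi).1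
  congr 1
  · exact Finset.prod_congr rfl fun i hi => Finset.prod_congr rfl fun j hj => by
      rw [h1 i hi, h2 j hj]
  · congr 3 <;> exact Finset.prod_congr rfl fun i hi => by first | rw [h1 i hi] | rw [h2 i hi]

lemma kernNum_mem_thetaSpace (δ κ a : ℂ) :
    (fun z => kernNum br δ κ (z - a)) ∈ thetaSpace br 3 (-3 * a) := by
  have := mul_mem_thetaSpace (mul_mem_thetaSpace (bracket_mem_thetaSpace (br := br) (-a + -δ))
    (bracket_mem_thetaSpace (-a + (δ - κ)))) (bracket_mem_thetaSpace (-a + κ))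
  convert this using 1
  · congr 1; ring
  · ext z
    simp only [kernNum, Pi.mul_apply, sub_eq_add_neg, add_assoc]

lemma kernDen_mem_thetaSpace (κ a : ℂ) :
    (fun z => kernDen br κ (z - a)) ∈ thetaSpace br 3 (-3 * a) := by
  have := mul_mem_thetaSpace (mul_mem_thetaSpace (bracket_mem_thetaSpace (br := br) (-a + 0))
    (bracket_mem_thetaSpace (-a + -κ))) (bracket_mem_thetaSpace (-a + κ))
  convert this using 1
  · congr 1; ring
  · ext z
    simp only [kernDen, Pi.mul_apply, sub_eq_add_neg, add_assoc]

omit [DecidableEq ι] in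
lemma prod_mem_thetaSpace_three {S : Finset ι} {x : ι → ℂ} {f : ℂ → ℂ}
    (h : ∀ a, (fun z => f (z - a)) ∈ thetaSpace br 3 (-3 * a)) :
    (fun z => ∏ i ∈ S, f (z - x i)) ∈ thetaSpace br (3 * S.card) (-3 * ∑ i ∈ S, x i) := by
  have := prod_mem_thetaSpace S (fun _ => 3) (fun i => -3 * x i) (fun i z => f (z - x i))
    fun i _ => h (x i)
  rw [Finset.sum_const, smul_eq_mul, mul_comm, ← Finset.mul_sum] at this
  convert this using 1
  ext z
  simp

lemma clearedSum_mem_thetaSpace (δ κ : ℂ) (S : Finset ι) (c : ℕ → ℂ) (x : ι → ℂ) :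
    clearedSum br δ κ S c x ∈ thetaSpace br (3 * S.card) (-3 * ∑ i ∈ S, x i) := by
  have hsplit : ∀ I ⊆ S, ∀ f g : ℂ → ℂ,
      (∀ a, (fun z => f (z - a)) ∈ thetaSpace br 3 (-3 * a)) →
      (∀ a, (fun z => g (z - a)) ∈ thetaSpace br 3 (-3 * a)) →
      (fun z => (∏ i ∈ I, f (z - x i)) * ∏ j ∈ S \ I, g (z - x j)) ∈
        thetaSpace br (3 * S.card) (-3 * ∑ i ∈ S, x i) := by
    intro I hI f g hf hg
    have := mul_mem_thetaSpace (prod_mem_thetaSpace_three (S := I) (x := x) hf)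
      (prod_mem_thetaSpace_three (S := S \ I) (x := x) hg)
    rw [← mul_add, ← mul_add, add_comm, add_comm (∑ i ∈ I, x i), Finset.sum_sdiff hI,
      Finset.card_sdiff_add_card_eq_card hI] at this
    exact this
  have : clearedSum br δ κ S c x = ∑ I ∈ S.powerset,
      (∏ i ∈ I, ∏ j ∈ S \ I, kern br δ κ (x i - x j)) •
      (c I.card • (fun z => (∏ i ∈ I, kernNum br (-δ) (-κ) (z - x i)) *
          ∏ j ∈ S \ I, kernDen br κ (z - x j))
        + c (I.card + 1) •
          fun z => (∏ i ∈ I, kernDen br κ (z - x i)) *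
            ∏ j ∈ S \ I, kernNum br δ κ (z - x j)) := by
    ext z
    rw [clearedSum, Finset.sum_apply]
    refine Finset.sum_congr rfl fun I _ => ?_
    simp only [Pi.smul_apply, Pi.add_apply, smul_eq_mul]
    ring
  rw [this]
  refine Submodule.sum_mem _ fun I hI => Submodule.smul_mem _ _ (add_mem ?_ ?_)
  · exact Submodule.smul_mem _ _ (hsplit I (Finset.mem_powerset.1 hI) _ _
      (kernNum_mem_thetaSpace _ _) (kernDen_mem_thetaSpace _))
  · exact Submodule.smul_mem _ _ (hsplit I (Finset.mem_powerset.1 hI) _ _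
      (kernDen_mem_thetaSpace _) (kernNum_mem_thetaSpace _ _))

variable (hb : IsBracket br) {δ κ : ℂ}
include hb

omit [DecidableEq ι] in
lemma SignGeneric.ne {S : Finset ι} {x : ι → ℂ} (hx : SignGeneric br κ S x) {i j : ι}
    (hi : i ∈ S) (hj : j ∈ S) (hij : i ≠ j) :
    br (x i - x j) ≠ 0 ∧ br (x i - x j - κ) ≠ 0 ∧ br (x i - x j + κ) ≠ 0 ∧
      br (x j - x i - κ) ≠ 0 := by
  refine ⟨?_, ?_, ?_, ?_⟩
  · simpa using (hx i hi j hj hij 0).1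
  · simpa [sub_eq_add_neg] using (hx i hi j hj hij (-1)).1
  · simpa using (hx i hi j hj hij 1).1
  · rw [show x j - x i - κ = -(x i - x j + κ) by ring, hb.odd, neg_ne_zero]
    simpa using (hx i hi j hj hij 1).1

/-- The difference of the cleared sums vanishes at `x b` and `x b ± κ`. -/
lemma clearedSum_sub_eq_zero {S : Finset ι} (c : ℕ → ℂ) {x : ι → ℂ}
    (hx : SignGeneric br κ S x) {b : ι} (hbS : b ∈ S)
    (ih : ∀ c, dualDefect br δ κ (S.erase b) c x = 0) {e : ℤ} (he : e ∈ ({-1, 0, 1} : Finset ℤ)) :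
    clearedSum br δ κ S c x (x b + e * κ) - clearedSum br (-δ) (-κ) S c x (x b + e * κ) = 0 := by
  have hmem : ∀ j ∈ S.erase b, j ∈ S ∧ j ≠ b := fun j hj =>
    ⟨Finset.mem_of_mem_erase hj, Finset.ne_of_mem_erase hj⟩
  have hnot := Finset.notMem_erase b S
  have hns : ∀ u : ℂ, u - -κ = u + κ := fun u => sub_neg_eq_add u κ
  rw [← Finset.insert_erase hbS]
  simp only [Finset.mem_insert, Finset.mem_singleton] at he
  rcases he with rfl | rfl | rfl
  · rw [show x b + ((-1 : ℤ) : ℂ) * κ = x b + -κ by push_cast; ring]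
    have h : ∀ j ∈ S.erase b, br (x j - x b) ≠ 0 ∧ br (x j - x b - -κ) ≠ 0 := fun j hj => by
      have := hx.ne hb (hmem j hj).1 hbS (hmem j hj).2
      rw [hns]
      exact ⟨this.1, this.2.2.1⟩
    have h1 := clearedSum_shifted_node hb (-δ) (-κ) hnot c x h
    have h2 := clearedSum_neg_shifted_node hb (-δ) (-κ) hnot c x h
    have h3 := ih fun n => c (n + 1)
    rw [dualDefect] at h3
    simp only [neg_neg] at h1 h2
    rw [h1, h2, ← mul_sub]
    exact mul_eq_zero_of_right _ h3
  · rw [show x b + ((0 : ℤ) : ℂ) * κ = x b by push_cast; ring]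
    rw [clearedSum_node hb δ κ hnot c x, clearedSum_node hb (-δ) (-κ) hnot c x, sub_zero]
    · intro j hj
      have := hx.ne hb hbS (hmem j hj).1 (hmem j hj).2.symm
      rw [hns, hns]
      refine ⟨this.1, this.2.2.1, ?_⟩
      rw [show x j - x b + κ = -(x b - x j - κ) by ring, hb.odd, neg_ne_zero]
      exact this.2.1
    · intro j hj
      have := hx.ne hb hbS (hmem j hj).1 (hmem j hj).2.symm
      exact ⟨this.1, this.2.1, this.2.2.2⟩
  · rw [show x b + ((1 : ℤ) : ℂ) * κ = x b + κ by push_cast; ring]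
    have h : ∀ j ∈ S.erase b, br (x j - x b) ≠ 0 ∧ br (x j - x b - κ) ≠ 0 := fun j hj => by
      have := hx.ne hb (hmem j hj).1 hbS (hmem j hj).2
      exact ⟨this.1, this.2.1⟩
    rw [clearedSum_shifted_node hb δ κ hnot c x h, clearedSum_neg_shifted_node hb δ κ hnot c x h,
      ← mul_sub]
    exact mul_eq_zero_of_right _ (ih fun n => c (n + 1))

lemma clearedSum_sub_eq {a : ι} {S : Finset ι} (ha : a ∉ S) (c : ℕ → ℂ) {x : ι → ℂ}
    (hx : SignGeneric br κ (insert a S) x) :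
    clearedSum br δ κ S c x (x a) - clearedSum br (-δ) (-κ) S c x (x a) =
      (∏ j ∈ S, kernDen br κ (x a - x j)) * dualDefect br δ κ (insert a S) c x := by
  have h : ∀ j ∈ S, _ := fun j hj => hx.ne hb (Finset.mem_insert_self a S)
    (Finset.mem_insert_of_mem hj) (fun e => ha (e ▸ hj))
  rw [clearedSum_eq hb δ κ ha c x fun j hj => ⟨(h j hj).1, (h j hj).2.1, (h j hj).2.2.2⟩,
    clearedSum_eq hb (-δ) (-κ) ha c x, dualDefect, mul_sub]
  · simp only [kernDen_neg]
  · intro j hj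
    rw [sub_neg_eq_add, sub_neg_eq_add]
    refine ⟨(h j hj).1, (h j hj).2.2.1, ?_⟩
    rw [show x j - x a + κ = -(x a - x j - κ) by ring, hb.odd, neg_ne_zero]
    exact (h j hj).2.1

omit hb [DecidableEq ι] in
lemma SignGeneric.mono {S T : Finset ι} {x : ι → ℂ} (hx : SignGeneric br κ S x) (h : T ⊆ S) :
    SignGeneric br κ T x := fun i hi j hj => hx i (h hi) j (h hj)

lemma SignGeneric.flipOn {S : Finset ι} {x : ι → ℂ} (hx : SignGeneric br κ S x) (T : Finset ι) :
    SignGeneric br κ S (flipOn T x) := by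
  intro i hi j hj hij n
  have h1 := hx i hi j hj hij n
  have h2 := hx i hi j hj hij (-n)
  have e1 : br (-x i - x j + n * κ) = -br (x i + x j + (-n : ℤ) * κ) := by
    rw [← hb.odd]; push_cast; ring_nf
  have e2 : br (-x i + x j + n * κ) = -br (x i - x j + (-n : ℤ) * κ) := by
    rw [← hb.odd]; push_cast; ring_nf
  unfold _root_.flipOn
  split_ifs
  · rw [sub_neg_eq_add, e2, ← sub_eq_add_neg, e1, neg_ne_zero, neg_ne_zero]
    exact h2
  · rw [e1, e2, neg_ne_zero, neg_ne_zero]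
    exact h2.symm
  · rw [sub_neg_eq_add, ← sub_eq_add_neg]
    exact h1.symm
  · exact h1

lemma dualDefect_flip_singleton (hκ : ∀ n : ℤ, n ≠ 0 → br (n * κ) ≠ 0) {a : ι} {S : Finset ι}
    (ha : a ∉ S) (c : ℕ → ℂ) {x : ι → ℂ} (hx : SignGeneric br κ (insert a S) x)
    (ih : ∀ b ∈ S, ∀ c, dualDefect br δ κ (S.erase b) c x = 0) :
    dualDefect br δ κ (insert a S) c (flipOn {a} x) = dualDefect br δ κ (insert a S) c x := by
  set x' := flipOn {a} x with hx'
  have hgen' : SignGeneric br κ (insert a S) x' := hx.flipOn hb {a}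
  have hxS : ∀ i ∈ S, x' i = x i := fun i hi => by
    have : i ≠ a := fun e => ha (e ▸ hi)
    simp [hx', flipOn, this]
  have hxa : x' a = -x a := by simp [hx', flipOn]
  have e1 := clearedSum_sub_eq hb (δ := δ) ha c hx
  have e2 := clearedSum_sub_eq hb (δ := δ) ha c hgen'
  rw [clearedSum_congr δ κ c hxS, clearedSum_congr (-δ) (-κ) c hxS] at e2
  have hden : ∀ w : ι → ℂ, SignGeneric br κ (insert a S) w →
      ∏ j ∈ S, kernDen br κ (w a - w j) ≠ 0 := by
    intro w hw
    refine Finset.prod_ne_zero_iff.2 fun j hj => ?_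
    have := hw.ne hb (Finset.mem_insert_self a S) (Finset.mem_insert_of_mem hj)
      (fun e => ha (e ▸ hj))
    rw [kernDen, add_zero, ← sub_eq_add_neg]
    exact mul_ne_zero (mul_ne_zero this.1 this.2.1) this.2.2.1
  set F : ℂ → ℂ := clearedSum br δ κ S c x - clearedSum br (-δ) (-κ) S c x with hF
  set H : ℂ → ℂ := fun z => ∏ j ∈ S, kernDen br κ (z - x j) with hH
  have hden2 : H (x' a) = ∏ j ∈ S, kernDen br κ (x' a - x' j) :=
    Finset.prod_congr rfl fun j hj => by rw [hxS j hj]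
  have key : H (x a) • F - F (x a) • H = 0 := by
    have hmem : H (x a) • F - F (x a) • H ∈ thetaSpace br (3 * S.card) (-3 * ∑ i ∈ S, x i) :=
      sub_mem (Submodule.smul_mem _ _ (sub_mem (clearedSum_mem_thetaSpace _ _ _ _ _)
        (clearedSum_mem_thetaSpace _ _ _ _ _)))
        (Submodule.smul_mem _ _ (prod_mem_thetaSpace_three (kernDen_mem_thetaSpace κ)))
    refine hb.eq_zero_of_mem_thetaSpace hmem
      (Finset.insertNone (S ×ˢ ({-1, 0, 1} : Finset ℤ)))
      (fun o => o.elim (x a) fun p => x p.1 + p.2 * κ) ?_ ?_ ?_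
    · rw [Finset.card_insertNone, Finset.card_product]
      simp [mul_comm]
    · have hcross : ∀ p ∈ S ×ˢ ({-1, 0, 1} : Finset ℤ), br (x a - (x p.1 + p.2 * κ)) ≠ 0 := by
        intro p hp
        have hpS := (Finset.mem_product.1 hp).1
        have := (hx a (Finset.mem_insert_self a S) p.1 (Finset.mem_insert_of_mem hpS)
          (fun e => ha (e ▸ hpS)) (-p.2)).1
        convert this using 2
        push_cast; ring
      rintro (_ | p) hp (_ | q) hq hne
      · exact absurd rfl hne
      · exact hcross q (by simpa using hq)
      · have := hcross p (by simpa using hp)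
        rwa [hb.map_sub_comm, neg_ne_zero] at this
      · rw [Finset.some_mem_insertNone] at hp hq
        have hp' := (Finset.mem_product.1 hp).1
        have hq' := (Finset.mem_product.1 hq).1
        have hval : x p.1 + p.2 * κ - (x q.1 + q.2 * κ) =
            x p.1 - x q.1 + ((p.2 - q.2 : ℤ) : ℂ) * κ := by push_cast; ring
        simp only [Option.elim_some, hval]
        by_cases h : p.1 = q.1
        · rw [h, sub_self, zero_add]
          refine hκ _ (sub_ne_zero.2 fun h2 => hne ?_)
          rw [Prod.ext h h2]
        · exact (hx p.1 (Finset.mem_insert_of_mem hp') q.1 (Finset.mem_insert_of_mem hq') h _).1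
    · rintro (_ | p) hp
      · simp [mul_comm]
      · rw [Finset.some_mem_insertNone] at hp
        have hpS := (Finset.mem_product.1 hp).1
        have hFz : F (x p.1 + p.2 * κ) = 0 :=
          clearedSum_sub_eq_zero hb c (hx.mono (Finset.subset_insert a S)) hpS (ih p.1 hpS)
            (Finset.mem_product.1 hp).2
        have hHz : H (x p.1 + p.2 * κ) = 0 := by
          refine Finset.prod_eq_zero hpS ?_
          have h2 := (Finset.mem_product.1 hp).2
          simp only [Finset.mem_insert, Finset.mem_singleton] at h2
          rcases h2 with h2 | h2 | h2 <;> simp [h2, kernDen, hb.map_zero]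
        simp [hFz, hHz]
  have hval := congr_fun key (x' a)
  simp only [Pi.sub_apply, Pi.smul_apply, smul_eq_mul, Pi.zero_apply] at hval
  have e1' : F (x a) = H (x a) * dualDefect br δ κ (insert a S) c x := e1
  have e2' : F (x' a) = H (x' a) * dualDefect br δ κ (insert a S) c x' := by rw [hden2]; exact e2
  have hn1 : H (x a) ≠ 0 := hden x hx
  have hn2 : H (x' a) ≠ 0 := by rw [hden2]; exact hden x' hgen'
  rw [e1', e2'] at hval
  apply mul_left_cancel₀ (mul_ne_zero hn1 hn2)
  linear_combination hval

/-- Duality of subset sums at generic points. -/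
theorem dualDefect_eq_zero (hκ : ∀ n : ℤ, n ≠ 0 → br (n * κ) ≠ 0) (n : ℕ) :
    ∀ (S : Finset ι) (_ : S.card = n) (c : ℕ → ℂ) (x : ι → ℂ), SignGeneric br κ S x →
      dualDefect br δ κ S c x = 0 := by
  induction n using Nat.strong_induction_on with
  | _ n ih =>
    intro S hS c x hx
    have step : ∀ T ⊆ S, dualDefect br δ κ S c (flipOn T x) = dualDefect br δ κ S c x := by
      intro T
      induction T using Finset.induction_on with
      | empty => intro _; exact dualDefect_congr δ κ c fun i _ => by simp [flipOn]
      | insert a T haT ihT =>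
        intro hT
        have haS : a ∈ S := hT (Finset.mem_insert_self a T)
        rw [← ihT ((Finset.subset_insert a T).trans hT)]
        have hflip : flipOn (insert a T) x = flipOn {a} (flipOn T x) := by
          ext i
          by_cases hi : i = a
          · subst hi; simp [flipOn, haT]
          · simp [flipOn, hi]
        have hcard := Finset.card_erase_lt_of_mem haS
        rw [hflip, ← Finset.insert_erase haS]
        apply dualDefect_flip_singleton hb hκ (Finset.notMem_erase a S)
        · rw [Finset.insert_erase haS]
          exact hx.flipOn hb T
        · intro b hb' c'
          have := Finset.card_erase_lt_of_mem hb'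
          exact ih _ (by omega) _ rfl _ _ ((hx.flipOn hb T).mono
            ((Finset.erase_subset _ _).trans (Finset.erase_subset _ _)))
    have h1 := step S subset_rfl
    have h2 : dualDefect br δ κ S c (flipOn S x) = -dualDefect br δ κ S c x := by
      rw [dualDefect, dualDefect, neg_sub]
      congr 1 <;> refine splitSum_congr fun i hi j hj _ => ?_
      · rw [flipOn, flipOn, if_pos hi, if_pos hj, kern_sub_neg_neg hb]; ring_nf
      · rw [flipOn, flipOn, if_pos hi, if_pos hj, kern_sub_neg_neg hb]; ring_nf
    linear_combination (h2 - h1) / 2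

end duality

/-- The summand of `T_k` with the shifted factorials of differences cancelled. -/
noncomputable def Tweight (br : ℂ → ℂ) (δ κ : ℂ) {m r : ℕ} (μ : Fin m → ℕ)
    (P : Finset (Fin r)) (x : Fin m → ℂ) (y : Fin r → ℂ) (z : Fin m → ℂ) : ℂ :=
  (∏ i ∈ P, ∏ j ∈ Pᶜ, kern br δ κ (y i - y j))
    * (∏ i : Fin m, ∏ j : Fin m, ∏ l ∈ Finset.range (μ i),
        (br (x i - x j + ((l : ℂ) - μ j + 1) * δ - κ) / br (x i - x j + ((l : ℂ) - μ j) * δ)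
          * (br (x i + z j + l * δ) / br (x i + z j + l * δ + δ - κ))))
    * ∏ i : Fin m,
        ((∏ j ∈ P,
            (br (z i + y j) * br (x i - y j + ((μ i : ℂ) - 1) * δ + κ))
              / (br (z i + y j + δ - κ) * br (x i - y j + (μ i : ℂ) * δ)))
          * ∏ j ∈ Pᶜ,
            (br (x i - y j - δ) * br (x i - y j + (μ i : ℂ) * δ - κ))
              / (br (x i - y j - κ) * br (x i - y j + ((μ i : ℂ) - 1) * δ)))

/-- Nonvanishing of everything that can occur in a denominator on either side of the
transformation, for all multi-indices at once. -/
structure Admissible (br : ℂ → ℂ) (δ κ : ℂ) {m r : ℕ} (x : Fin m → ℂ) (y : Fin r → ℂ)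
    (z : Fin m → ℂ) : Prop where
  lattice : ∀ n : ℤ, n ≠ 0 → br (n * δ) ≠ 0
  lattice_sub : ∀ n : ℤ, br (n * δ - κ) ≠ 0
  xx : ∀ i j, i ≠ j → ∀ n : ℤ, br (x i - x j + n * δ) ≠ 0 ∧ br (x i - x j + n * δ - κ) ≠ 0
  zz : ∀ i j, i ≠ j → ∀ n : ℤ, br (z i - z j + n * δ) ≠ 0 ∧ br (z i - z j + n * δ - κ) ≠ 0
  xz : ∀ i j, ∀ n : ℤ, br (x i + z j + n * δ - κ) ≠ 0
  xy : ∀ i j, ∀ n : ℤ, br (x i - y j + n * δ) ≠ 0 ∧ br (x i - y j + n * δ - κ) ≠ 0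
  zy : ∀ i j, ∀ n : ℤ, br (z i + y j + n * δ) ≠ 0 ∧ br (z i + y j + n * δ - κ) ≠ 0
  yy : ∀ i j, i ≠ j → br (y i - y j) ≠ 0 ∧ br (y i - y j - κ) ≠ 0

lemma Admissible.dual {br : ℂ → ℂ} {δ κ : ℂ} {m r : ℕ} {x : Fin m → ℂ}
    {y : Fin r → ℂ} {z : Fin m → ℂ} (h : Admissible br δ κ x y z) :
    Admissible br δ κ z (fun j => -y j - δ) x where
  lattice := h.lattice
  lattice_sub := h.lattice_sub
  xx := h.zz
  zz := h.xx
  xz i j n := by rw [add_comm (z i)]; exact h.xz j i n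
  xy i j n := by
    rw [show z i - (-y j - δ) + n * δ = z i + y j + (n + 1 : ℤ) * δ by push_cast; ring]
    exact h.zy i j (n + 1)
  zy i j n := by
    rw [show x i + (-y j - δ) + n * δ = x i - y j + (n - 1 : ℤ) * δ by push_cast; ring]
    exact h.xy i j (n - 1)
  yy i j hij := by
    rw [show -y i - δ - (-y j - δ) = y j - y i by ring]
    exact h.yy j i hij.symm

section telescope

variable {br : ℂ → ℂ} {δ κ : ℂ}

lemma prod_Ico_kern (u : ℂ) {a b : ℕ} (hab : a ≤ b)
    (h0 : ∀ l : ℕ, a ≤ l → l < b → br (u - l * δ) ≠ 0) (ha : br (u - a * δ) ≠ 0)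
    (h1 : ∀ n : ℤ, br (u + n * δ - κ) ≠ 0) :
    ∏ l ∈ Finset.Ico a b, kern br δ κ (u - l * δ) =
      br (u + (1 - a) * δ - κ) / br (u - a * δ) * (br (u - b * δ) / br (u - b * δ + δ - κ)) := by
  induction b, hab using Nat.le_induction with
  | base =>
    have h := h1 (1 - a)
    push_cast at h
    rw [show u - a * δ + δ - κ = u + (1 - a) * δ - κ by ring]
    simp only [Finset.Ico_self, Finset.prod_empty]
    field_simp
  | succ b hab ih =>
    have hb0 := h0 b hab (Nat.lt_succ_self b)
    have hb1 := h1 (1 - b)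
    have hb2 := h1 (-b)
    push_cast at hb1 hb2
    rw [Finset.prod_Ico_succ_top hab, ih fun l hl hlb => h0 l hl (hlb.trans (Nat.lt_succ_self b)),
      kern, show u - b * δ + δ - κ = u + (1 - b) * δ - κ by ring,
      show u - b * δ - κ = u + -b * δ - κ by ring,
      show u - (b + 1 : ℕ) * δ + δ - κ = u + -b * δ - κ by push_cast; ring,
      show u - (b + 1 : ℕ) * δ = u - b * δ - δ by push_cast; ring]
    generalize br (u - b * δ) = A at *
    generalize br (u + (1 - b) * δ - κ) = B at *
    generalize br (u + -b * δ - κ) = C at *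
    field_simp

lemma prod_range_kern (u : ℂ) (b : ℕ) (h0 : ∀ n : ℤ, br (u + n * δ) ≠ 0)
    (h1 : ∀ n : ℤ, br (u + n * δ - κ) ≠ 0) :
    ∏ l ∈ Finset.range b, kern br δ κ (u + l * δ) =
      br (u - δ) * br (u + b * δ - κ) / (br (u - κ) * br (u + (b - 1) * δ)) := by
  induction b with
  | zero =>
    have ha := h0 (-1)
    have hb := h1 0
    push_cast at ha hb
    rw [zero_mul, add_zero] at hb
    rw [show u + -1 * δ = u - δ by ring] at ha
    rw [show u + (((0 : ℕ) : ℂ) - 1) * δ = u - δ by push_cast; ring, Nat.cast_zero, zero_mul,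
      add_zero, Finset.range_zero, Finset.prod_empty]
    field_simp
  | succ b ih =>
    have hb0 := h0 (b - 1)
    have hb1 := h0 b
    have hb2 := h1 b
    push_cast at hb0 hb1 hb2
    rw [Finset.prod_range_succ, ih, kern,
      show u + ((b + 1 : ℕ) - 1) * δ = u + b * δ by push_cast; ring,
      show u + b * δ - δ = u + (b - 1) * δ by ring,
      show u + (b + 1 : ℕ) * δ - κ = u + b * δ + δ - κ by push_cast; ring]
    generalize br (u + (b - 1) * δ) = A at *
    generalize br (u + b * δ) = B at *
    generalize br (u + b * δ - κ) = C at *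
    field_simp

end telescope

/-- The points of the principal specialization: `y` together with the strings `x i + l δ`. -/
noncomputable def stringPoint (δ : ℂ) {m r : ℕ} (x : Fin m → ℂ) (y : Fin r → ℂ) :
    Fin r ⊕ (Σ _ : Fin m, ℕ) → ℂ :=
  Sum.elim y fun p => x p.1 + p.2 * δ

/-- Index set of the principal specialization with strings of lengths `N`. -/
def stringIdx {m r : ℕ} (P : Finset (Fin r)) (N : Fin m → ℕ) :
    Finset (Fin r ⊕ (Σ _ : Fin m, ℕ)) :=
  P.disjSum (Finset.univ.sigma fun i => Finset.range (N i))

section strings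

variable {br : ℂ → ℂ} {δ κ : ℂ} {m r : ℕ}

lemma stringIdx_univ_sdiff (P : Finset (Fin r)) (μ N : Fin m → ℕ) :
    stringIdx Finset.univ N \ stringIdx P μ =
      Pᶜ.disjSum (Finset.univ.sigma fun i => Finset.Ico (μ i) (N i)) := by
  ext (j | ⟨i, l⟩)
  · simp [stringIdx]
  · simp [stringIdx, and_comm]

lemma prod_kern_strings (hb : IsBracket br) {x : Fin m → ℂ} {y : Fin r → ℂ} {N : Fin m → ℕ}
    (h : Admissible br δ κ x y fun i => -x i - N i * δ) (P : Finset (Fin r)) {μ : Fin m → ℕ}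
    (hμ : ∀ i, μ i ≤ N i) :
    ∏ a ∈ stringIdx P μ, ∏ b ∈ stringIdx Finset.univ N \ stringIdx P μ,
        kern br δ κ (stringPoint δ x y a - stringPoint δ x y b) =
      Tweight br δ κ μ P x y fun i => -x i - N i * δ := by
  have hxx : ∀ i j, ∀ l ∈ Finset.range (μ i),
      ∏ l' ∈ Finset.Ico (μ j) (N j), kern br δ κ (x i + l * δ - (x j + l' * δ)) =
        br (x i - x j + ((l : ℂ) - μ j + 1) * δ - κ) / br (x i - x j + ((l : ℂ) - μ j) * δ)
          * (br (x i + (-x j - N j * δ) + l * δ) /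
            br (x i + (-x j - N j * δ) + l * δ + δ - κ)) := by
    intro i j l hl
    have hl := Finset.mem_range.1 hl
    have hne : ∀ l' : ℕ, μ j ≤ l' → br (x i - x j + l * δ - l' * δ) ≠ 0 := by
      intro l' hl'
      rw [show x i - x j + l * δ - l' * δ = x i - x j + ((l - l' : ℤ) : ℂ) * δ by push_cast; ring]
      by_cases hij : i = j
      · subst hij
        rw [sub_self, zero_add]
        exact h.lattice _ (by omega)
      · exact (h.xx i j hij _).1
    have hneκ : ∀ n : ℤ, br (x i - x j + l * δ + n * δ - κ) ≠ 0 := by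
      intro n
      rw [show x i - x j + l * δ + n * δ = x i - x j + ((l + n : ℤ) : ℂ) * δ by push_cast; ring]
      by_cases hij : i = j
      · subst hij
        rw [sub_self, zero_add]
        exact h.lattice_sub _
      · exact (h.xx i j hij _).2
    have := prod_Ico_kern (br := br) (x i - x j + l * δ) (hμ j) (fun l' h1 _ => hne l' h1)
      (hne _ le_rfl) hneκ
    rw [show x i - x j + ((l : ℂ) - μ j + 1) * δ - κ =
        x i - x j + l * δ + (1 - μ j) * δ - κ by ring,
      show x i - x j + ((l : ℂ) - μ j) * δ = x i - x j + l * δ - μ j * δ by ring,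
      show x i + (-x j - N j * δ) + l * δ = x i - x j + l * δ - N j * δ by ring, ← this]
    exact Finset.prod_congr rfl fun l' _ => by congr 1; ring
  have hyx : ∀ i, ∀ j, ∏ l ∈ Finset.Ico (μ i) (N i), kern br δ κ (y j - (x i + l * δ)) =
      (br (-x i - N i * δ + y j) * br (x i - y j + ((μ i : ℂ) - 1) * δ + κ))
        / (br (-x i - N i * δ + y j + δ - κ) * br (x i - y j + (μ i : ℂ) * δ)) := by
    intro i j
    have hne : ∀ n : ℤ, br (y j - x i + n * δ) ≠ 0 := fun n => by
      rw [show y j - x i + n * δ = -(x i - y j + (-n : ℤ) * δ) by push_cast; ring, hb.odd,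
        neg_ne_zero]
      exact (h.xy i j _).1
    have hneκ : ∀ n : ℤ, br (y j - x i + n * δ - κ) ≠ 0 := fun n => by
      have := (h.zy i j (n + N i)).2
      convert this using 2
      push_cast; ring
    have hne' : ∀ l : ℕ, br (y j - x i - l * δ) ≠ 0 := fun l => by
      have := hne (-l)
      push_cast at this
      rwa [neg_mul, ← sub_eq_add_neg] at this
    have := prod_Ico_kern (br := br) (y j - x i) (hμ i) (fun l _ _ => hne' l) (hne' _) hneκ
    rw [show x i - y j + ((μ i : ℂ) - 1) * δ + κ = -(y j - x i + (1 - μ i) * δ - κ) by ring,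
      show x i - y j + (μ i : ℂ) * δ = -(y j - x i - μ i * δ) by ring,
      show -x i - N i * δ + y j = y j - x i - N i * δ by ring, hb.odd, hb.odd, mul_neg, mul_neg,
      neg_div_neg_eq, mul_comm, mul_comm (br (y j - x i - N i * δ + δ - κ)), mul_div_mul_comm,
      ← this]
    exact Finset.prod_congr rfl fun l' _ => by congr 1; ring
  have hxy : ∀ i, ∀ j, ∏ l ∈ Finset.range (μ i), kern br δ κ (x i + l * δ - y j) =
      (br (x i - y j - δ) * br (x i - y j + (μ i : ℂ) * δ - κ))
        / (br (x i - y j - κ) * br (x i - y j + ((μ i : ℂ) - 1) * δ)) := by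
    intro i j
    rw [← prod_range_kern (x i - y j) (μ i) (fun n => (h.xy i j n).1) fun n => (h.xy i j n).2]
    exact Finset.prod_congr rfl fun l' _ => by congr 1; ring
  rw [stringIdx_univ_sdiff, stringIdx, Finset.prod_disjSum]
  simp only [Finset.prod_disjSum, Finset.prod_sigma, stringPoint, Sum.elim_inl, Sum.elim_inr,
    Finset.prod_mul_distrib]
  have e1 : ∏ j ∈ P, ∏ i, ∏ l ∈ Finset.Ico (μ i) (N i), kern br δ κ (y j - (x i + l * δ)) =
      ∏ i, ∏ j ∈ P, (br (-x i - N i * δ + y j) * br (x i - y j + ((μ i : ℂ) - 1) * δ + κ))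
        / (br (-x i - N i * δ + y j + δ - κ) * br (x i - y j + (μ i : ℂ) * δ)) := by
    rw [Finset.prod_comm]
    simp only [hyx]
  have e2 : ∏ i, ∏ l ∈ Finset.range (μ i), ∏ j ∈ Pᶜ, kern br δ κ (x i + l * δ - y j) =
      ∏ i, ∏ j ∈ Pᶜ, (br (x i - y j - δ) * br (x i - y j + (μ i : ℂ) * δ - κ))
        / (br (x i - y j - κ) * br (x i - y j + ((μ i : ℂ) - 1) * δ)) := by
    refine Finset.prod_congr rfl fun i _ => ?_
    rw [Finset.prod_comm]
    simp only [hxy]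
  have e3 : ∏ i, ∏ l ∈ Finset.range (μ i), ∏ j, ∏ l' ∈ Finset.Ico (μ j) (N j),
      kern br δ κ (x i + l * δ - (x j + l' * δ)) =
      ∏ i, ∏ j, ∏ l ∈ Finset.range (μ i),
        (br (x i - x j + ((l : ℂ) - μ j + 1) * δ - κ) / br (x i - x j + ((l : ℂ) - μ j) * δ)
          * (br (x i + (-x j - N j * δ) + l * δ) /
            br (x i + (-x j - N j * δ) + l * δ + δ - κ))) := by
    refine Finset.prod_congr rfl fun i _ => ?_
    rw [Finset.prod_comm]
    exact Finset.prod_congr rfl fun j _ => Finset.prod_congr rfl fun l hl => hxx i j l hl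
  rw [e1, e2, e3, Tweight, Finset.prod_mul_distrib]
  ring

end strings

section stringSum

variable {br : ℂ → ℂ} {δ κ : ℂ} {m r : ℕ}

lemma mem_TIdx {k : ℕ} {p : (Fin m → ℕ) × Finset (Fin r)} :
    p ∈ TIdx m r k ↔ ∑ i, p.1 i + p.2.card = k := by
  simp only [TIdx, Finset.mem_filter, Finset.mem_product, Fintype.mem_piFinset, Finset.mem_range,
    Finset.mem_univ, and_true, and_iff_right_iff_imp]
  intro h i
  have := Finset.single_le_sum (f := p.1) (fun _ _ => Nat.zero_le _) (Finset.mem_univ i)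
  omega

lemma card_stringIdx (P : Finset (Fin r)) (μ : Fin m → ℕ) :
    (stringIdx P μ).card = ∑ i, μ i + P.card := by
  simp [stringIdx, Finset.card_disjSum, add_comm]

lemma stringIdx_injective : Function.Injective fun p : (Fin m → ℕ) × Finset (Fin r) =>
    stringIdx p.2 p.1 := by
  rintro ⟨μ, P⟩ ⟨ν, Q⟩ h
  have h : stringIdx P μ = stringIdx Q ν := h
  have hP : P = Q := by
    ext j
    simpa [stringIdx] using Finset.ext_iff.1 h (Sum.inl j)
  have hμ : μ = ν := by
    ext i
    have hi : ∀ l, l < μ i ↔ l < ν i := fun l => by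
      simpa [stringIdx] using Finset.ext_iff.1 h (Sum.inr ⟨i, l⟩)
    exact le_antisymm (not_lt.1 fun hlt => lt_irrefl _ ((hi _).1 hlt))
      (not_lt.1 fun hlt => lt_irrefl _ ((hi _).2 hlt))
  rw [hP, hμ]

lemma exists_initial_segment {D : ℕ → Prop} {N : ℕ} (hD : ∀ l, D (l + 1) → D l)
    (hN : ∀ l, D l → l < N) : ∃ M ≤ N, ∀ l, D l ↔ l < M := by
  classical
  have hex : ∃ l, ¬ D l := ⟨N, fun h => lt_irrefl _ (hN _ h)⟩
  refine ⟨Nat.find hex, Nat.find_min' hex fun h => lt_irrefl _ (hN _ h), fun l => ?_⟩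
  refine ⟨fun hl => not_le.1 fun hle => Nat.find_spec hex ?_, fun hl => not_not.1 ?_⟩
  · exact Nat.decreasingInduction (motive := fun n _ => D n) (fun n _ h => hD n h) hl hle
  · exact Nat.find_min hex hl

lemma Tweight_eq_zero_of_lt (hb : IsBracket br) (x : Fin m → ℂ) (y : Fin r → ℂ) {N : Fin m → ℕ}
    (P : Finset (Fin r)) {μ : Fin m → ℕ} {i : Fin m} (hi : N i < μ i) :
    (Tweight br δ κ μ P x y fun i => -x i - N i * δ) = 0 := by
  rw [Tweight, Finset.prod_eq_zero (Finset.mem_univ i), mul_zero, zero_mul]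
  refine Finset.prod_eq_zero (Finset.mem_univ i)
    (Finset.prod_eq_zero (Finset.mem_range.2 hi) ?_)
  rw [show x i + (-x i - N i * δ) + N i * δ = 0 by ring, hb.map_zero, zero_div, mul_zero]

/-- At the principal specialization the sum is a subset sum over the strings. -/
lemma sum_Tweight_eq_splitSum (hb : IsBracket br) {x z : Fin m → ℂ} {y : Fin r → ℂ}
    {N : Fin m → ℕ} (hz : ∀ i, z i = -x i - N i * δ) (h : Admissible br δ κ x y z) (k : ℕ) :
    ∑ p ∈ TIdx m r k, Tweight br δ κ p.1 p.2 x y z =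
      splitSum (stringIdx Finset.univ N) (fun n => if n = k then 1 else 0)
        fun a b => kern br δ κ (stringPoint δ x y a - stringPoint δ x y b) := by
  classical
  obtain rfl : z = fun i => -x i - N i * δ := funext hz
  rw [← Finset.sum_filter_of_ne (p := fun p => ∀ i, p.1 i ≤ N i)]
  swap
  · intro p _ hp i
    by_contra hlt
    exact hp (Tweight_eq_zero_of_lt hb x y p.2 (not_le.1 hlt))
  refine Finset.sum_of_injOn (fun p => stringIdx p.2 p.1) stringIdx_injective.injOn ?_ ?_ ?_
  · intro p hp
    have hp := (Finset.mem_filter.1 hp).2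
    rw [Finset.mem_coe, Finset.mem_powerset]
    rintro (j | ⟨i, l⟩) ha
    · simp [stringIdx]
    · simp only [stringIdx, Finset.inr_mem_disjSum, Finset.mem_sigma, Finset.mem_univ,
        Finset.mem_range, true_and] at ha ⊢
      exact ha.trans_le (hp i)
  · intro I hI hnot
    have hI := Finset.mem_powerset.1 hI
    by_contra hne
    obtain ⟨hc, hprod⟩ := mul_ne_zero_iff.1 hne
    have hk : I.card = k := by
      by_contra hk
      exact hc (if_neg hk)
    have hdown : ∀ i l, Sum.inr ⟨i, l + 1⟩ ∈ I → Sum.inr ⟨i, l⟩ ∈ I := by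
      intro i l hl
      by_contra hl'
      have hS := hI hl
      refine hprod (Finset.prod_eq_zero hl (Finset.prod_eq_zero (i := Sum.inr ⟨i, l⟩)
        (Finset.mem_sdiff.2 ⟨?_, hl'⟩) ?_))
      · simp only [stringIdx, Finset.inr_mem_disjSum, Finset.mem_sigma, Finset.mem_univ,
          Finset.mem_range, true_and] at hS ⊢
        exact (Nat.lt_succ_self l).trans hS
      · simp only [stringPoint, Sum.elim_inr, kern]
        rw [show x i + ((l + 1 : ℕ) : ℂ) * δ - (x i + l * δ) - δ = 0 by push_cast; ring,
          hb.map_zero, zero_mul, zero_div]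
    have hlt : ∀ i l, Sum.inr ⟨i, l⟩ ∈ I → l < N i := fun i l hl => by
      simpa [stringIdx] using hI hl
    choose μ hμ hiff using fun i => exists_initial_segment (hdown i) (hlt i)
    have hIe : I = stringIdx (Finset.univ.filter fun j => Sum.inl j ∈ I) μ := by
      ext (j | ⟨i, l⟩)
      · simp [stringIdx]
      · simp [stringIdx, hiff]
    refine hnot ⟨(μ, Finset.univ.filter fun j => Sum.inl j ∈ I), ?_, hIe.symm⟩
    rw [Finset.mem_coe, Finset.mem_filter, mem_TIdx, ← card_stringIdx, ← hIe]
    exact ⟨hk, hμ⟩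
  · intro p hp
    obtain ⟨hp, hle⟩ := Finset.mem_filter.1 hp
    dsimp only
    rw [prod_kern_strings hb h p.2 hle, card_stringIdx, mem_TIdx.1 hp, if_pos rfl, one_mul]

/-- Reversal of an initial segment of `ℕ`. -/
def reverseRange (N : ℕ) : Equiv.Perm ℕ :=
  Function.Involutive.toPerm (fun l => if l < N then N - 1 - l else l) fun l => by
    dsimp only
    split_ifs <;> omega

lemma reverseRange_lt_iff (N l : ℕ) : reverseRange N l < N ↔ l < N := by
  change (if l < N then N - 1 - l else l) < N ↔ l < N
  split_ifs <;> omega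

lemma reverseRange_add {N l : ℕ} (hl : l < N) : reverseRange N l + l + 1 = N := by
  change (if l < N then N - 1 - l else l) + l + 1 = N
  rw [if_pos hl]
  omega

/-- Reversal of all the strings. -/
def reverseStrings {m r : ℕ} (N : Fin m → ℕ) : Equiv.Perm (Fin r ⊕ (Σ _ : Fin m, ℕ)) :=
  Equiv.sumCongr (Equiv.refl _) (Equiv.sigmaCongrRight fun i => reverseRange (N i))

lemma map_reverseStrings (N : Fin m → ℕ) :
    (stringIdx (r := r) Finset.univ N).map (reverseStrings N).toEmbedding =
      stringIdx Finset.univ N := by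
  have hmem : ∀ a, reverseStrings N a ∈ stringIdx (r := r) Finset.univ N ↔
      a ∈ stringIdx Finset.univ N := by
    rintro (j | ⟨i, l⟩)
    · simp [stringIdx, reverseStrings]
    · simp [stringIdx, reverseStrings, reverseRange_lt_iff]
  ext a
  obtain ⟨b, rfl⟩ := (reverseStrings N).surjective a
  rw [hmem]
  simp

/-- The transformation at the principal specialization. -/
lemma sum_Tweight_strings (hb : IsBracket br) (hκ : ∀ n : ℤ, n ≠ 0 → br (n * κ) ≠ 0)
    {x : Fin m → ℂ} {y : Fin r → ℂ} {z : Fin m → ℂ} {N : Fin m → ℕ}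
    (hz : ∀ i, z i = -x i - N i * δ) (h : Admissible br δ κ x y z)
    (hgen : SignGeneric br κ (stringIdx Finset.univ N) (stringPoint δ x y)) (k : ℕ) :
    ∑ p ∈ TIdx m r k, Tweight br δ κ p.1 p.2 x y z =
      ∑ p ∈ TIdx m r k, Tweight br δ κ p.1 p.2 z (fun j => -y j - δ) x := by
  rw [sum_Tweight_eq_splitSum hb hz h,
    sum_Tweight_eq_splitSum hb (N := N) (fun i => by rw [hz]; ring) h.dual,
    ← splitSum_equiv (reverseStrings N) (map_reverseStrings N) _ fun a b =>
      kern br δ κ (stringPoint δ z (fun j => -y j - δ) a - stringPoint δ z (fun j => -y j - δ) b),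
    sub_eq_zero.1 (dualDefect_eq_zero hb (δ := δ) hκ _ _ rfl _ _ hgen)]
  have hrev : ∀ a ∈ stringIdx Finset.univ N, stringPoint δ z (fun j => -y j - δ)
      (reverseStrings N a) = -stringPoint δ x y a - δ := by
    rintro (j | ⟨i, l⟩) ha
    · rfl
    · have hl : l < N i := by simpa [stringIdx] using ha
      have hN : ((reverseRange (N i) l + l + 1 : ℕ) : ℂ) = N i := by rw [reverseRange_add hl]
      push_cast at hN
      change z i + (reverseRange (N i) l : ℂ) * δ = -(x i + l * δ) - δ
      rw [hz, ← hN]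
      ring
  refine splitSum_congr fun a ha b hb' _ => ?_
  rw [hrev a ha, hrev b hb', kern_sub_neg_neg hb]
  congr 1
  ring

end stringSum

/-- On `T`, the function `q` is a quotient of two theta functions of the same degree whose shifts
differ by `σ`. -/
def ThetaQuotient (br : ℂ → ℂ) (T : Set ℂ) (σ : ℂ) (q : ℂ → ℂ) : Prop :=
  ∃ d s, ∃ f ∈ thetaSpace br d (s + σ), ∃ g ∈ thetaSpace br d s,
    ∀ t ∈ T, g t ≠ 0 ∧ q t = f t / g t

namespace ThetaQuotient

variable {br : ℂ → ℂ} {T : Set ℂ} {σ τ : ℂ} {p q : ℂ → ℂ}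

lemma congr (hq : ThetaQuotient br T σ q) (hσ : τ = σ) (h : ∀ t ∈ T, p t = q t) :
    ThetaQuotient br T τ p := by
  obtain ⟨d, s, f, hf, g, hg, hfg⟩ := hq
  exact ⟨d, s, f, hσ ▸ hf, g, hg, fun t ht => ⟨(hfg t ht).1, (h t ht).trans (hfg t ht).2⟩⟩

lemma const (c : ℂ) : ThetaQuotient br T 0 fun _ => c :=
  ⟨0, 0, c • 1, Submodule.smul_mem _ _ (by simpa using one_mem_thetaSpace), 1,
    one_mem_thetaSpace, fun t _ => by simp⟩

lemma mul (hp : ThetaQuotient br T σ p) (hq : ThetaQuotient br T τ q) :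
    ThetaQuotient br T (σ + τ) fun t => p t * q t := by
  obtain ⟨d, s, f, hf, g, hg, hfg⟩ := hp
  obtain ⟨d', s', f', hf', g', hg', hfg'⟩ := hq
  refine ⟨d + d', s + s', f * f', ?_, g * g', mul_mem_thetaSpace hg hg', fun t ht => ?_⟩
  · rw [add_add_add_comm]
    exact mul_mem_thetaSpace hf hf'
  · refine ⟨mul_ne_zero (hfg t ht).1 (hfg' t ht).1, ?_⟩
    dsimp only
    rw [(hfg t ht).2, (hfg' t ht).2, Pi.mul_apply, Pi.mul_apply, mul_div_mul_comm]

lemma add (hp : ThetaQuotient br T σ p) (hq : ThetaQuotient br T σ q) :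
    ThetaQuotient br T σ fun t => p t + q t := by
  obtain ⟨d, s, f, hf, g, hg, hfg⟩ := hp
  obtain ⟨d', s', f', hf', g', hg', hfg'⟩ := hq
  refine ⟨d + d', s + s', f * g' + g * f', add_mem ?_ ?_, g * g', mul_mem_thetaSpace hg hg',
    fun t ht => ?_⟩
  · rw [add_right_comm]
    exact mul_mem_thetaSpace hf hg'
  · rw [add_assoc]
    exact mul_mem_thetaSpace hg hf'
  · refine ⟨mul_ne_zero (hfg t ht).1 (hfg' t ht).1, ?_⟩
    dsimp only
    rw [(hfg t ht).2, (hfg' t ht).2, div_add_div _ _ (hfg t ht).1 (hfg' t ht).1]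
    rfl

lemma sum {ι : Type*} (S : Finset ι) {q : ι → ℂ → ℂ}
    (hq : ∀ i ∈ S, ThetaQuotient br T σ (q i)) : ThetaQuotient br T σ fun t => ∑ i ∈ S, q i t := by
  classical
  induction S using Finset.induction_on with
  | empty =>
    exact ⟨0, 0, 0, zero_mem _, 1, one_mem_thetaSpace, fun t _ => by simp⟩
  | insert a S ha ih =>
    simp only [Finset.sum_insert ha]
    exact (hq a (Finset.mem_insert_self a S)).add
      (ih fun i hi => hq i (Finset.mem_insert_of_mem hi))

lemma prod {ι : Type*} (S : Finset ι) {σ : ι → ℂ} {q : ι → ℂ → ℂ}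
    (hq : ∀ i ∈ S, ThetaQuotient br T (σ i) (q i)) :
    ThetaQuotient br T (∑ i ∈ S, σ i) fun t => ∏ i ∈ S, q i t := by
  classical
  induction S using Finset.induction_on with
  | empty => simpa using const 1
  | insert a S ha ih =>
    simp only [Finset.prod_insert ha, Finset.sum_insert ha]
    exact (hq a (Finset.mem_insert_self a S)).mul
      (ih fun i hi => hq i (Finset.mem_insert_of_mem hi))

lemma sub (hp : ThetaQuotient br T σ p) (hq : ThetaQuotient br T σ q) :
    ThetaQuotient br T σ fun t => p t - q t :=
  (hp.add ((const (-1)).mul hq |>.congr (zero_add σ).symm fun _ _ => rfl)).congr rfl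
    fun t _ => by ring

lemma bracket_div (hb : IsBracket br) {ε c : ℂ} (hε : ε = 0 ∨ ε = 1 ∨ ε = -1) {u : ℂ → ℂ}
    (hu : ∀ t, u t = ε * t + c) (a b : ℂ) (h : ∀ t ∈ T, br (u t + b) ≠ 0) :
    ThetaQuotient br T (ε * (a - b)) fun t => br (u t + a) / br (u t + b) := by
  rcases hε with rfl | rfl | rfl
  · exact (const (br (c + a) / br (c + b))).congr (by ring) fun t _ => by
      rw [hu, zero_mul, zero_add]
  · refine ⟨1, c + b, fun t => br (t + (c + a)), ?_, fun t => br (t + (c + b)),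
      bracket_mem_thetaSpace _, fun t ht => ?_⟩
    · rw [show c + b + 1 * (a - b) = c + a by ring]
      exact bracket_mem_thetaSpace _
    · have := h t ht
      rw [hu, one_mul, add_assoc] at this
      exact ⟨this, by simp only [hu, one_mul, add_assoc]⟩
  · refine ⟨1, -c - b, fun t => br (t + (-c - a)), ?_, fun t => br (t + (-c - b)),
      bracket_mem_thetaSpace _, fun t ht => ?_⟩
    · rw [show -c - b + -1 * (a - b) = -c - a by ring]
      exact bracket_mem_thetaSpace _
    · have e : ∀ a, br (u t + a) = -br (t + (-c - a)) := fun a => by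
        rw [← hb.odd, hu]
        congr 1
        ring
      have := h t ht
      rw [e, neg_ne_zero] at this
      exact ⟨this, by simp only [e, neg_div_neg_eq]⟩

lemma eq_zero (hb : IsBracket br) (hq : ThetaQuotient br T σ q) (b : ℕ → ℂ)
    (hbT : ∀ n, b n ∈ T) (hdist : ∀ i j, i ≠ j → br (b i - b j) ≠ 0) (hz : ∀ n, q (b n) = 0)
    {t : ℂ} (ht : t ∈ T) : q t = 0 := by
  obtain ⟨d, s, f, hf, g, hg, hfg⟩ := hq
  have hf0 : f = 0 := hb.eq_zero_of_mem_thetaSpace hf (Finset.range (d + 1)) b (by simp)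
    (fun i _ j _ => hdist i j) fun i _ => by
      have := hz i
      rw [(hfg _ (hbT i)).2, div_eq_zero_iff] at this
      exact this.resolve_right (hfg _ (hbT i)).1
  rw [(hfg t ht).2, hf0, Pi.zero_apply, zero_div]

end ThetaQuotient

section interpolation

variable {br : ℂ → ℂ} {δ κ : ℂ} {m r : ℕ}

/-- The values of the coordinate `z s` for which the data are admissible. -/
def admissibleLine (br : ℂ → ℂ) (δ κ : ℂ) (x : Fin m → ℂ) (y : Fin r → ℂ) (z : Fin m → ℂ)
    (s : Fin m) : Set ℂ :=
  {t | Admissible br δ κ x y (Function.update z s t)}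

lemma update_eq_affine (z : Fin m → ℂ) (s i : Fin m) (t : ℂ) :
    Function.update z s t i = (if i = s then 1 else 0) * t + if i = s then 0 else z i := by
  rw [Function.update_apply]
  split_ifs <;> simp

lemma thetaQuotient_Tweight (hb : IsBracket br) (x : Fin m → ℂ) (y : Fin r → ℂ) (z : Fin m → ℂ)
    (s : Fin m) (μ : Fin m → ℕ) (P : Finset (Fin r)) :
    ThetaQuotient br (admissibleLine br δ κ x y z s) ((∑ i, μ i + P.card : ℕ) * (κ - δ))
      fun t => Tweight br δ κ μ P x y (Function.update z s t) := by
  have hε : ∀ i, (if i = s then (1 : ℂ) else 0) = 0 ∨ (if i = s then (1 : ℂ) else 0) = 1 ∨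
      (if i = s then (1 : ℂ) else 0) = -1 := fun i => by split_ifs <;> simp
  have hmid : ThetaQuotient br (admissibleLine br δ κ x y z s)
      (∑ i, ∑ j, ∑ _l ∈ Finset.range (μ i), (if j = s then 1 else 0) * (κ - δ))
      fun t => ∏ i : Fin m, ∏ j : Fin m, ∏ l ∈ Finset.range (μ i),
        (br (x i - x j + ((l : ℂ) - μ j + 1) * δ - κ) / br (x i - x j + ((l : ℂ) - μ j) * δ)
          * (br (x i + Function.update z s t j + l * δ) /
            br (x i + Function.update z s t j + l * δ + δ - κ))) := by
    refine ThetaQuotient.prod _ fun i _ => ThetaQuotient.prod _ fun j _ =>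
      ThetaQuotient.prod _ fun l _ => ?_
    refine ((ThetaQuotient.const (br (x i - x j + ((l : ℂ) - μ j + 1) * δ - κ) /
      br (x i - x j + ((l : ℂ) - μ j) * δ))).mul (ThetaQuotient.bracket_div hb (hε j)
      (update_eq_affine z s j) (x i + l * δ) (x i + l * δ + δ - κ) fun t ht => ?_)).congr
      ?_ fun t _ => ?_
    · have := Admissible.xz ht i j (l + 1)
      convert this using 2
      push_cast; ring
    · ring
    · congr 3 <;> ring
  have hlast : ThetaQuotient br (admissibleLine br δ κ x y z s)
      (∑ i : Fin m, (∑ _j ∈ P, (if i = s then 1 else 0) * (κ - δ) + 0)) fun t =>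
      ∏ i : Fin m,
        ((∏ j ∈ P,
            (br (Function.update z s t i + y j) * br (x i - y j + ((μ i : ℂ) - 1) * δ + κ))
              / (br (Function.update z s t i + y j + δ - κ) * br (x i - y j + (μ i : ℂ) * δ)))
          * ∏ j ∈ Pᶜ,
            (br (x i - y j - δ) * br (x i - y j + (μ i : ℂ) * δ - κ))
              / (br (x i - y j - κ) * br (x i - y j + ((μ i : ℂ) - 1) * δ))) := by
    refine ThetaQuotient.prod _ fun i _ => (ThetaQuotient.prod _ fun j _ => ?_).mul
      (ThetaQuotient.const _)
    refine ((ThetaQuotient.bracket_div hb (hε i) (update_eq_affine z s i) (y j) (y j + δ - κ)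
      fun t ht => ?_).mul (ThetaQuotient.const
        (br (x i - y j + ((μ i : ℂ) - 1) * δ + κ) / br (x i - y j + (μ i : ℂ) * δ)))).congr
      ?_ fun t _ => ?_
    · have := (Admissible.zy ht i j 1).2
      convert this using 2
      push_cast; ring
    · ring
    · rw [mul_div_mul_comm]
      congr 3
      ring
  refine (((ThetaQuotient.const _).mul hmid).mul hlast).congr ?_ fun t _ => rfl
  simp only [ite_mul, one_mul, zero_mul, Finset.sum_const, Finset.card_range, add_zero, smul_ite,
    mul_zero, Finset.sum_ite_eq', Finset.mem_univ, if_true, zero_add, nsmul_eq_mul]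
  push_cast
  rw [add_mul, Finset.sum_mul]

lemma thetaQuotient_Tweight_dual (hb : IsBracket br) (x : Fin m → ℂ) (y : Fin r → ℂ)
    (z : Fin m → ℂ) (s : Fin m) (μ : Fin m → ℕ) (P : Finset (Fin r)) :
    ThetaQuotient br (admissibleLine br δ κ x y z s) ((∑ i, μ i + P.card : ℕ) * (κ - δ))
      fun t => Tweight br δ κ μ P (Function.update z s t) (fun j => -y j - δ) x := by
  have hε : ∀ i, (if i = s then (1 : ℂ) else 0) = 0 ∨ (if i = s then (1 : ℂ) else 0) = 1 ∨
      (if i = s then (1 : ℂ) else 0) = -1 := fun i => by split_ifs <;> simp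
  have hε' : ∀ i j, (if i = s then (1 : ℂ) else 0) - (if j = s then (1 : ℂ) else 0) = 0 ∨
      (if i = s then (1 : ℂ) else 0) - (if j = s then (1 : ℂ) else 0) = 1 ∨
      (if i = s then (1 : ℂ) else 0) - (if j = s then (1 : ℂ) else 0) = -1 :=
    fun i j => by split_ifs <;> simp
  have hmid : ThetaQuotient br (admissibleLine br δ κ x y z s)
      (∑ i, ∑ j, ∑ _l ∈ Finset.range (μ i), (if j = s then 1 else 0) * (κ - δ))
      fun t => ∏ i : Fin m, ∏ j : Fin m, ∏ l ∈ Finset.range (μ i),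
        (br (Function.update z s t i - Function.update z s t j + ((l : ℂ) - μ j + 1) * δ - κ) /
            br (Function.update z s t i - Function.update z s t j + ((l : ℂ) - μ j) * δ)
          * (br (Function.update z s t i + x j + l * δ) /
            br (Function.update z s t i + x j + l * δ + δ - κ))) := by
    refine ThetaQuotient.prod _ fun i _ => ThetaQuotient.prod _ fun j _ =>
      ThetaQuotient.prod _ fun l hl => ?_
    have hl := Finset.mem_range.1 hl
    refine ((ThetaQuotient.bracket_div hb (hε' i j)
      (c := (if i = s then 0 else z i) - if j = s then 0 else z j)
      (u := fun t => Function.update z s t i - Function.update z s t j) (fun t => ?_)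
      (((l : ℂ) - μ j + 1) * δ - κ) (((l : ℂ) - μ j) * δ) fun t ht => ?_).mul
      (ThetaQuotient.bracket_div hb (hε i) (update_eq_affine z s i) (x j + l * δ)
        (x j + l * δ + δ - κ) fun t ht => ?_)).congr ?_ fun t _ => ?_
    · simp only [update_eq_affine]
      ring
    · rw [show ((l : ℂ) - μ j) = ((l - μ j : ℤ) : ℂ) by push_cast; ring]
      by_cases hij : i = j
      · subst hij
        rw [sub_self, zero_add]
        exact Admissible.lattice ht _ (by omega)
      · exact (Admissible.zz ht i j hij _).1
    · have := Admissible.xz ht j i (l + 1)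
      convert this using 2
      push_cast; ring
    · ring
    · congr 3 <;> ring
  have hlast : ThetaQuotient br (admissibleLine br δ κ x y z s)
      (∑ i : Fin m, (∑ _j ∈ P, (if i = s then 1 else 0) * (κ - δ) + ∑ _j ∈ Pᶜ, 0)) fun t =>
      ∏ i : Fin m,
        ((∏ j ∈ P,
            (br (x i + (-y j - δ)) *
                br (Function.update z s t i - (-y j - δ) + ((μ i : ℂ) - 1) * δ + κ))
              / (br (x i + (-y j - δ) + δ - κ) *
                br (Function.update z s t i - (-y j - δ) + (μ i : ℂ) * δ)))
          * ∏ j ∈ Pᶜ,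
            (br (Function.update z s t i - (-y j - δ) - δ) *
                br (Function.update z s t i - (-y j - δ) + (μ i : ℂ) * δ - κ))
              / (br (Function.update z s t i - (-y j - δ) - κ) *
                br (Function.update z s t i - (-y j - δ) + ((μ i : ℂ) - 1) * δ))) := by
    refine ThetaQuotient.prod _ fun i _ => (ThetaQuotient.prod _ fun j _ => ?_).mul
      (ThetaQuotient.prod _ fun j _ => ?_)
    · refine ((ThetaQuotient.const (br (x i + (-y j - δ)) / br (x i + (-y j - δ) + δ - κ))).mul
        (ThetaQuotient.bracket_div hb (hε i) (update_eq_affine z s i) (y j + μ i * δ + κ)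
          (y j + (μ i + 1) * δ) fun t ht => ?_)).congr ?_ fun t _ => ?_
      · have := (Admissible.zy ht i j (μ i + 1)).1
        convert this using 2
        push_cast; ring
      · ring
      · rw [mul_div_mul_comm]
        congr 3 <;> ring
    · refine ((ThetaQuotient.bracket_div hb (hε i) (update_eq_affine z s i) (y j)
        (y j + δ - κ) fun t ht => ?_).mul
        (ThetaQuotient.bracket_div hb (hε i) (update_eq_affine z s i) (y j + (μ i + 1) * δ - κ)
          (y j + μ i * δ) fun t ht => ?_)).congr ?_ fun t _ => ?_
      · have := (Admissible.zy ht i j 1).2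
        convert this using 2
        push_cast; ring
      · have := (Admissible.zy ht i j (μ i)).1
        convert this using 2
        push_cast; ring
      · ring
      · rw [mul_div_mul_comm]
        congr 3 <;> ring
  refine (((ThetaQuotient.const _).mul hmid).mul hlast).congr ?_ fun t _ => rfl
  simp only [ite_mul, one_mul, zero_mul, Finset.sum_const, Finset.card_range, add_zero, smul_ite,
    mul_zero, Finset.sum_ite_eq', Finset.mem_univ, if_true, zero_add, nsmul_eq_mul]
  push_cast
  rw [add_mul, Finset.sum_mul]

end interpolation

/-- No bracket of a nontrivial integral combination of the relevant shape vanishes. -/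
structure BracketGeneric (br : ℂ → ℂ) (δ κ : ℂ) {ι : Type*} (w : ι → ℂ) : Prop where
  lattice : ∀ n l : ℤ, (n ≠ 0 ∨ l ≠ 0) → br (n * δ + l * κ) ≠ 0
  sub : ∀ i j, i ≠ j → ∀ n l : ℤ, br (w i - w j + (n * δ + l * κ)) ≠ 0
  add : ∀ i j, ∀ n l : ℤ, br (w i + w j + (n * δ + l * κ)) ≠ 0

namespace BracketGeneric

variable {br : ℂ → ℂ} {δ κ : ℂ} {m r : ℕ} {x z : Fin m → ℂ} {y : Fin r → ℂ}

section

variable {ι : Type*} {w : ι → ℂ} (h : BracketGeneric br δ κ w)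
include h

lemma lattice_ne {u : ℂ} (n l : ℤ) (hnl : n ≠ 0 ∨ l ≠ 0) (hu : u = n * δ + l * κ) : br u ≠ 0 :=
  hu ▸ h.lattice n l hnl

lemma sub_ne {u : ℂ} (i j : ι) (hij : i ≠ j) (n l : ℤ) (hu : u = w i - w j + (n * δ + l * κ)) :
    br u ≠ 0 :=
  hu ▸ h.sub i j hij n l

lemma add_ne {u : ℂ} (i j : ι) (n l : ℤ) (hu : u = w i + w j + (n * δ + l * κ)) : br u ≠ 0 :=
  hu ▸ h.add i j n l

lemma neg_add_ne (hb : IsBracket br) {u : ℂ} (i j : ι) (n l : ℤ)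
    (hu : u = -(w i + w j + (n * δ + l * κ))) : br u ≠ 0 := by
  rw [hu, hb.odd, neg_ne_zero]
  exact h.add i j n l

end

lemma admissible (hb : IsBracket br)
    (h : BracketGeneric br δ κ (Sum.elim x (Sum.elim z y) : Fin m ⊕ Fin m ⊕ Fin r → ℂ))
    {z' : Fin m → ℂ} (hz' : ∀ i, z' i = z i ∨ ∃ N : ℕ, z' i = -x i - N * δ) :
    Admissible br δ κ x y z' := by
  have hzz : ∀ i j, i ≠ j → ∀ n l : ℤ, br (z' i - z' j + n * δ + l * κ) ≠ 0 := by
    intro i j hij n l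
    rcases hz' i with hi | ⟨N, hi⟩ <;> rcases hz' j with hj | ⟨M, hj⟩ <;> rw [hi, hj]
    · exact h.sub_ne (.inr (.inl i)) (.inr (.inl j)) (by simpa using hij) n l
        (by simp only [Sum.elim_inr, Sum.elim_inl]; ring)
    · exact h.add_ne (.inr (.inl i)) (.inl j) (M + n) l
        (by simp only [Sum.elim_inr, Sum.elim_inl]; push_cast; ring)
    · exact h.neg_add_ne hb (.inl i) (.inr (.inl j)) (N - n) (-l)
        (by simp only [Sum.elim_inr, Sum.elim_inl]; push_cast; ring)
    · exact h.sub_ne (.inl j) (.inl i) (by simpa using hij.symm) (n + M - N) l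
        (by simp only [Sum.elim_inl]; push_cast; ring)
  have hzy : ∀ i j, ∀ n l : ℤ, br (z' i + y j + n * δ + l * κ) ≠ 0 := by
    intro i j n l
    rcases hz' i with hi | ⟨N, hi⟩ <;> rw [hi]
    · exact h.add_ne (.inr (.inl i)) (.inr (.inr j)) n l
        (by simp only [Sum.elim_inr, Sum.elim_inl]; ring)
    · exact h.sub_ne (.inr (.inr j)) (.inl i) (by simp) (n - N) l
        (by simp only [Sum.elim_inr, Sum.elim_inl]; push_cast; ring)
  constructor
  · exact fun n hn => h.lattice_ne n 0 (Or.inl hn) (by push_cast; ring)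
  · exact fun n => h.lattice_ne n (-1) (by simp) (by push_cast; ring)
  · intro i j hij n
    have hij : (Sum.inl i : Fin m ⊕ Fin m ⊕ Fin r) ≠ .inl j := by simpa using hij
    exact ⟨h.sub_ne _ _ hij n 0 (by simp only [Sum.elim_inl]; push_cast; ring),
      h.sub_ne _ _ hij n (-1) (by simp only [Sum.elim_inl]; push_cast; ring)⟩
  · intro i j hij n
    have h0 := hzz i j hij n 0
    have h1 := hzz i j hij n (-1)
    push_cast at h0 h1
    rw [zero_mul, add_zero] at h0
    rw [neg_one_mul, ← sub_eq_add_neg] at h1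
    exact ⟨h0, h1⟩
  · intro i j n
    rcases hz' j with hj | ⟨N, hj⟩ <;> rw [hj]
    · exact h.add_ne (.inl i) (.inr (.inl j)) n (-1)
        (by simp only [Sum.elim_inr, Sum.elim_inl]; push_cast; ring)
    · by_cases hij : i = j
      · subst hij
        exact h.lattice_ne (n - N) (-1) (by simp) (by push_cast; ring)
      · exact h.sub_ne (.inl i) (.inl j) (by simpa using hij) (n - N) (-1)
          (by simp only [Sum.elim_inl]; push_cast; ring)
  · intro i j n
    exact ⟨h.sub_ne (.inl i) (.inr (.inr j)) (by simp) n 0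
        (by simp only [Sum.elim_inr, Sum.elim_inl]; push_cast; ring),
      h.sub_ne (.inl i) (.inr (.inr j)) (by simp) n (-1)
        (by simp only [Sum.elim_inr, Sum.elim_inl]; push_cast; ring)⟩
  · intro i j n
    have h0 := hzy i j n 0
    have h1 := hzy i j n (-1)
    push_cast at h0 h1
    rw [zero_mul, add_zero] at h0
    rw [neg_one_mul, ← sub_eq_add_neg] at h1
    exact ⟨h0, h1⟩
  · intro i j hij
    have hij : (Sum.inr (.inr i) : Fin m ⊕ Fin m ⊕ Fin r) ≠ .inr (.inr j) := by simpa using hij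
    exact ⟨h.sub_ne _ _ hij 0 0 (by simp only [Sum.elim_inr]; push_cast; ring),
      h.sub_ne _ _ hij 0 (-1) (by simp only [Sum.elim_inr]; push_cast; ring)⟩

lemma signGeneric
    (h : BracketGeneric br δ κ (Sum.elim x (Sum.elim z y) : Fin m ⊕ Fin m ⊕ Fin r → ℂ))
    (S : Finset (Fin r ⊕ (Σ _ : Fin m, ℕ))) : SignGeneric br κ S (stringPoint δ x y) := by
  rintro (i | ⟨i, l⟩) - (j | ⟨j, l'⟩) - hij n <;>
    simp only [stringPoint, Sum.elim_inl, Sum.elim_inr]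
  · exact ⟨h.sub_ne (.inr (.inr i)) (.inr (.inr j)) (by simpa using hij) 0 n
        (by simp only [Sum.elim_inr]; push_cast; ring),
      h.add_ne (.inr (.inr i)) (.inr (.inr j)) 0 n
        (by simp only [Sum.elim_inr]; push_cast; ring)⟩
  · exact ⟨h.sub_ne (.inr (.inr i)) (.inl j) (by simp) (-l') n
        (by simp only [Sum.elim_inr, Sum.elim_inl]; push_cast; ring),
      h.add_ne (.inr (.inr i)) (.inl j) l' n
        (by simp only [Sum.elim_inr, Sum.elim_inl]; push_cast; ring)⟩
  · exact ⟨h.sub_ne (.inl i) (.inr (.inr j)) (by simp) l n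
        (by simp only [Sum.elim_inr, Sum.elim_inl]; push_cast; ring),
      h.add_ne (.inl i) (.inr (.inr j)) l n
        (by simp only [Sum.elim_inr, Sum.elim_inl]; push_cast; ring)⟩
  · refine ⟨?_, h.add_ne (.inl i) (.inl j) (l + l') n
        (by simp only [Sum.elim_inl]; push_cast; ring)⟩
    by_cases he : i = j
    · subst he
      have hl : l ≠ l' := by rintro rfl; exact hij rfl
      exact h.lattice_ne (l - l') n (Or.inl (by omega)) (by push_cast; ring)
    · exact h.sub_ne (.inl i) (.inl j) (by simpa using he) (l - l') n
        (by simp only [Sum.elim_inl]; push_cast; ring)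

/-- The transformation for the cancelled summands, at generic points. -/
lemma sum_Tweight (hb : IsBracket br)
    (h : BracketGeneric br δ κ (Sum.elim x (Sum.elim z y) : Fin m ⊕ Fin m ⊕ Fin r → ℂ)) (k : ℕ) :
    ∑ p ∈ TIdx m r k, Tweight br δ κ p.1 p.2 x y z =
      ∑ p ∈ TIdx m r k, Tweight br δ κ p.1 p.2 z (fun j => -y j - δ) x := by
  suffices key : ∀ (S : Finset (Fin m)) (z' : Fin m → ℂ), (∀ i ∈ S, z' i = z i) →
      (∀ i ∉ S, ∃ N : ℕ, z' i = -x i - N * δ) →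
      ∑ p ∈ TIdx m r k, Tweight br δ κ p.1 p.2 x y z' =
        ∑ p ∈ TIdx m r k, Tweight br δ κ p.1 p.2 z' (fun j => -y j - δ) x from
    key Finset.univ z (fun _ _ => rfl) fun i hi => absurd (Finset.mem_univ i) hi
  intro S
  induction S using Finset.induction_on with
  | empty =>
    intro z' _ hz'
    choose N hN using fun i => hz' i (Finset.notMem_empty i)
    exact sum_Tweight_strings hb (fun n hn => h.lattice_ne 0 n (Or.inr hn) (by push_cast; ring))
      hN (h.admissible hb fun i => Or.inr ⟨N i, hN i⟩) (h.signGeneric _) k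
  | insert s S hs ih =>
    intro z' hz' hz''
    have hS : ∀ t, ∀ i ∈ S, Function.update z' s t i = z i := fun t i hi => by
      rw [Function.update_of_ne (ne_of_mem_of_not_mem hi hs), hz' i (Finset.mem_insert_of_mem hi)]
    have hS' : ∀ n : ℕ, ∀ i ∉ S, ∃ N : ℕ,
        Function.update z' s (-x s - n * δ) i = -x i - N * δ := fun n i hi => by
      by_cases his : i = s
      · subst his
        exact ⟨n, by rw [Function.update_self]⟩
      · rw [Function.update_of_ne his]
        exact hz'' i fun hmem => (Finset.mem_insert.1 hmem).elim his hi
    have hq : ThetaQuotient br (admissibleLine br δ κ x y z' s) (k * (κ - δ)) fun t =>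
        ∑ p ∈ TIdx m r k, Tweight br δ κ p.1 p.2 x y (Function.update z' s t) -
          ∑ p ∈ TIdx m r k,
            Tweight br δ κ p.1 p.2 (Function.update z' s t) (fun j => -y j - δ) x := by
      refine (ThetaQuotient.sum _ fun p hp => ?_).sub (ThetaQuotient.sum _ fun p hp => ?_)
      · rw [← mem_TIdx.1 hp]
        exact thetaQuotient_Tweight hb x y z' s p.1 p.2
      · rw [← mem_TIdx.1 hp]
        exact thetaQuotient_Tweight_dual hb x y z' s p.1 p.2
    have hmem : z' s ∈ admissibleLine br δ κ x y z' s := by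
      rw [admissibleLine, Set.mem_ofPred_eq, Function.update_eq_self]
      refine h.admissible hb fun i => ?_
      by_cases hi : i ∈ insert s S
      · exact Or.inl (hz' i hi)
      · exact Or.inr (hz'' i hi)
    have h0 := hq.eq_zero hb (fun n : ℕ => -x s - n * δ)
      (fun n => h.admissible hb fun i => ?_) (fun i j hij => ?_)
      (fun n => sub_eq_zero.2 (ih _ (hS _) (hS' n))) hmem
    · rw [Function.update_eq_self] at h0
      exact sub_eq_zero.1 h0
    · by_cases hi : i ∈ S
      · exact Or.inl (hS _ i hi)
      · exact Or.inr (hS' n i hi)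
    · exact h.lattice_ne (j - i) 0 (Or.inl (by omega)) (by push_cast; ring)

end BracketGeneric

section sfac

variable {br : ℂ → ℂ}

lemma sfac_natCast (a u : ℂ) (n : ℕ) :
    sfac br a u n = ∏ l ∈ Finset.range n, br (u + l * a) := by
  simp [sfac]

lemma sfac_neg_natCast (a u : ℂ) (n : ℕ) :
    sfac br a u (-n) = (∏ l ∈ Finset.range n, br (u + (-n + l) * a))⁻¹ := by
  rcases Nat.eq_zero_or_pos n with rfl | hn
  · simp [sfac]
  · rw [sfac, if_neg (by omega)]
    simp

lemma sfac_add_one {a u : ℂ} {n : ℤ} (h : n < 0 → br (u + n * a) ≠ 0) :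
    sfac br a u (n + 1) = sfac br a u n * br (u + n * a) := by
  rcases lt_or_ge n 0 with hn | hn
  · obtain ⟨p, rfl⟩ : ∃ p : ℕ, n = -((p + 1 : ℕ) : ℤ) := ⟨(-n - 1).toNat, by omega⟩
    have h := h hn
    rw [show -((p + 1 : ℕ) : ℤ) + 1 = -(p : ℤ) by push_cast; ring, sfac_neg_natCast,
      sfac_neg_natCast, Finset.prod_range_succ', mul_inv, mul_assoc]
    have e : ∀ l : ℕ, u + (-((p + 1 : ℕ) : ℂ) + ((l + 1 : ℕ) : ℂ)) * a = u + (-p + l) * a := by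
      intro l
      push_cast; ring
    simp only [e]
    push_cast at h ⊢
    rw [add_zero, inv_mul_cancel₀ h, mul_one]
  · lift n to ℕ using hn
    rw [show (n : ℤ) + 1 = ((n + 1 : ℕ) : ℤ) by push_cast; rfl, sfac_natCast, sfac_natCast,
      Finset.prod_range_succ]
    rfl

lemma sfac_add {a u : ℂ} {n : ℤ} (k : ℕ) (h : ∀ l : ℤ, n ≤ l → l < 0 → br (u + l * a) ≠ 0) :
    sfac br a u (n + k) = sfac br a u n * ∏ l ∈ Finset.range k, br (u + (n + l) * a) := by
  induction k with
  | zero => simp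
  | succ k ih =>
    rw [show n + ((k + 1 : ℕ) : ℤ) = n + k + 1 by push_cast; ring,
      sfac_add_one fun hl => h _ (by omega) hl, ih, Finset.prod_range_succ, mul_assoc]
    push_cast
    rfl

lemma sfac_ne_zero {a u : ℂ} {n : ℤ} (h : ∀ l : ℤ, n ≤ l → l < 0 → br (u + l * a) ≠ 0)
    (h' : ∀ l : ℤ, 0 ≤ l → l < n → br (u + l * a) ≠ 0) : sfac br a u n ≠ 0 := by
  rcases le_total 0 n with hn | hn
  · lift n to ℕ using hn
    rw [sfac_natCast]
    refine Finset.prod_ne_zero_iff.2 fun l hl => ?_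
    have := h' l (by omega) (by have := Finset.mem_range.1 hl; omega)
    exact_mod_cast this
  · obtain ⟨p, rfl⟩ : ∃ p : ℕ, n = -(p : ℤ) := ⟨(-n).toNat, by omega⟩
    rw [sfac_neg_natCast]
    refine inv_ne_zero (Finset.prod_ne_zero_iff.2 fun l hl => ?_)
    have := h (-p + l) (by omega) (by have := Finset.mem_range.1 hl; omega)
    exact_mod_cast this

end sfac

lemma Tterm_eq_Tweight {br : ℂ → ℂ} {δ κ : ℂ} {m r : ℕ} (hb : IsBracket br) {x z : Fin m → ℂ}
    {y : Fin r → ℂ} (h : Admissible br δ κ x y z) (μ : Fin m → ℕ) (P : Finset (Fin r)) :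
    Tterm br δ κ μ P x y z = Tweight br δ κ μ P x y z := by
  have hκ : ∀ i j, i ≠ j → ∀ n : ℤ, br (x i - x j + κ + n * δ) ≠ 0 := fun i j hij n => by
    rw [show x i - x j + κ + n * δ = -(x j - x i + (-n : ℤ) * δ - κ) by push_cast; ring, hb.odd,
      neg_ne_zero]
    exact (h.xx j i hij.symm _).2
  have hδ : ∀ i j, i ≠ j → ∀ n : ℤ, br (x i - x j + δ + n * δ) ≠ 0 := fun i j hij n => by
    rw [show x i - x j + δ + n * δ = x i - x j + (n + 1 : ℤ) * δ by push_cast; ring]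
    exact (h.xx i j hij _).1
  have hpair : ∀ i j,
      (sfac br δ (x i - x j + δ) ((μ i : ℤ) - (μ j : ℤ))
            / sfac br δ (x i - x j + κ) ((μ i : ℤ) - (μ j : ℤ)))
          * ((sfac br δ (x i - x j + κ) (μ i : ℤ) * sfac br δ (x i + z j) (μ i : ℤ))
              / (sfac br δ (x i - x j + δ) (μ i : ℤ)
                * sfac br δ (x i + z j + δ - κ) (μ i : ℤ))) =
        (∏ l ∈ Finset.range (μ j), br (x i - x j + κ + (μ i - μ j + l) * δ) /
            br (x i - x j + δ + (μ i - μ j + l) * δ)) *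
          ∏ l ∈ Finset.range (μ i), br (x i + z j + l * δ) / br (x i + z j + l * δ + δ - κ) := by
    intro i j
    have hsplit : ∀ a, (i ≠ j → ∀ n : ℤ, br (x i - x j + a + n * δ) ≠ 0) →
        sfac br δ (x i - x j + a) (μ i - μ j : ℤ) ≠ 0 ∧
        sfac br δ (x i - x j + a) (μ i : ℤ) = sfac br δ (x i - x j + a) (μ i - μ j : ℤ) *
          ∏ l ∈ Finset.range (μ j), br (x i - x j + a + (μ i - μ j + l) * δ) := by
      intro a ha
      have hrange : ∀ l : ℤ, ((μ i - μ j : ℤ) ≤ l ∧ l < 0 ∨ 0 ≤ l ∧ l < (μ i - μ j : ℤ)) →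
          br (x i - x j + a + l * δ) ≠ 0 := by
        intro l hl
        refine ha (fun hij => ?_) l
        subst hij
        omega
      refine ⟨sfac_ne_zero (fun l h1 h2 => hrange l (Or.inl ⟨h1, h2⟩))
        fun l h1 h2 => hrange l (Or.inr ⟨h1, h2⟩), ?_⟩
      have := sfac_add (br := br) (n := (μ i - μ j : ℤ)) (μ j)
        fun l h1 h2 => hrange l (Or.inl ⟨h1, h2⟩)
      rw [sub_add_cancel] at this
      rw [this]
      push_cast
      rfl
    obtain ⟨hδ0, hδ1⟩ := hsplit δ (hδ i j)
    obtain ⟨hκ0, hκ1⟩ := hsplit κ (hκ i j)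
    rw [hδ1, hκ1, Finset.prod_div_distrib, Finset.prod_div_distrib, sfac_natCast, sfac_natCast,
      show ∏ l ∈ Finset.range (μ i), br (x i + z j + δ - κ + l * δ) =
        ∏ l ∈ Finset.range (μ i), br (x i + z j + l * δ + δ - κ) from
        Finset.prod_congr rfl fun l _ => by congr 1; ring]
    generalize sfac br δ (x i - x j + δ) (μ i - μ j : ℤ) = A at *
    generalize sfac br δ (x i - x j + κ) (μ i - μ j : ℤ) = B at *
    rw [mul_assoc A, mul_assoc B, mul_div_mul_comm B, ← mul_assoc, div_mul_div_comm, mul_comm A,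
      div_self (mul_ne_zero hκ0 hδ0), one_mul, mul_div_mul_comm]
  have hrefl : ∀ i j, ∏ l ∈ Finset.range (μ i), br (x j - x i + κ + (μ j - μ i + l) * δ) /
        br (x j - x i + δ + (μ j - μ i + l) * δ) =
      ∏ l ∈ Finset.range (μ i), br (x i - x j + ((l : ℂ) - μ j + 1) * δ - κ) /
        br (x i - x j + ((l : ℂ) - μ j) * δ) := by
    intro i j
    rw [← Finset.prod_range_reflect]
    refine Finset.prod_congr rfl fun l hl => ?_
    have hl := Finset.mem_range.1 hl
    have hc : ((μ i - 1 - l : ℕ) : ℂ) = μ i - 1 - l := by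
      rw [Nat.cast_sub (by omega), Nat.cast_sub (by omega), Nat.cast_one]
    rw [hc, show x j - x i + κ + (μ j - μ i + (μ i - 1 - l)) * δ =
        -(x i - x j + ((l : ℂ) - μ j + 1) * δ - κ) by ring,
      show x j - x i + δ + (μ j - μ i + (μ i - 1 - l)) * δ =
        -(x i - x j + ((l : ℂ) - μ j) * δ) by ring, hb.odd, hb.odd, neg_div_neg_eq]
  rw [Tterm, Tweight]
  simp only [kern, hpair]
  congr 2
  simp only [Finset.prod_mul_distrib]
  congr 1
  rw [Finset.prod_comm]
  simp only [hrefl]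

/-- The transformation at generic points. -/
lemma BracketGeneric.Tsum_eq {br : ℂ → ℂ} {δ κ : ℂ} {m r : ℕ} (hb : IsBracket br)
    {x z : Fin m → ℂ} {y : Fin r → ℂ}
    (h : BracketGeneric br δ κ (Sum.elim x (Sum.elim z y) : Fin m ⊕ Fin m ⊕ Fin r → ℂ)) (k : ℕ) :
    Tsum br δ κ m r k x y z = Tsum br δ κ m r k z (fun j => -y j - δ) x := by
  have hadm := h.admissible hb (z' := z) fun _ => Or.inl rfl
  simp only [Tsum, Tterm_eq_Tweight hb hadm, Tterm_eq_Tweight hb hadm.dual]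
  exact h.sum_Tweight hb k

section density

variable {br : ℂ → ℂ}

lemma IsBracket.residual_ne (hb : IsBracket br) {E : Type*} [NormedAddCommGroup E]
    [NormedSpace ℂ E] {f : E → ℂ} (hf : Continuous f) (v : E) {c : ℂ} (hc : c ≠ 0)
    (hv : ∀ e t, f (e + t • v) = f e + t * c) : ∀ᶠ e in residual E, br (f e) ≠ 0 := by
  refine residual_of_dense_open (hb.isOpen_ne.preimage hf) fun e => ?_
  have hd : Dense {t : ℂ | br (f e + t * c) ≠ 0} := hb.dense_ne.preimage
    ((Homeomorph.mulRight₀ c hc).trans (Homeomorph.addLeft (f e))).isOpenMap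
  have hg : Continuous fun t : ℂ => e + t • v := by fun_prop
  have := map_mem_closure hg (hd 0) (t := f ⁻¹' {u | br u ≠ 0}) fun t ht => by
    have ht : br (f e + t * c) ≠ 0 := ht
    rw [← hv] at ht
    exact ht
  simpa using this

/-- Genericity holds on a dense set of points and parameters. -/
lemma IsBracket.dense_bracketGeneric (hb : IsBracket br) (ι : Type*) [Fintype ι] :
    Dense {e : (ι → ℂ) × ℂ × ℂ | BracketGeneric br e.2.1 e.2.2 e.1} := by
  classical
  have hlat : ∀ᶠ e : (ι → ℂ) × ℂ × ℂ in residual _, ∀ n l : ℤ, (n ≠ 0 ∨ l ≠ 0) →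
      br (n * e.2.1 + l * e.2.2) ≠ 0 := by
    simp only [Filter.eventually_all, eventually_countable_forall]
    rintro n l (hn | hl)
    · exact hb.residual_ne (by fun_prop) (0, 1, 0) (Int.cast_ne_zero.2 hn) fun e t => by
        simp only [Prod.snd_add, Prod.fst_add, Prod.smul_snd, Prod.smul_fst, smul_eq_mul]; ring
    · exact hb.residual_ne (by fun_prop) (0, 0, 1) (Int.cast_ne_zero.2 hl) fun e t => by
        simp only [Prod.snd_add, Prod.fst_add, Prod.smul_snd, Prod.smul_fst, smul_eq_mul]; ring
  have hsub : ∀ᶠ e : (ι → ℂ) × ℂ × ℂ in residual _, ∀ i j, i ≠ j → ∀ n l : ℤ,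
      br (e.1 i - e.1 j + (n * e.2.1 + l * e.2.2)) ≠ 0 := by
    simp only [Filter.eventually_all, eventually_countable_forall]
    intro i j hij n l
    refine hb.residual_ne (by fun_prop) (Pi.single i 1, 0, 0) one_ne_zero fun e t => ?_
    simp only [Prod.snd_add, Prod.fst_add, Prod.smul_snd, Prod.smul_fst, smul_eq_mul,
      Pi.add_apply, Pi.smul_apply, Pi.single_eq_same, Pi.single_eq_of_ne hij.symm]
    ring
  have hadd : ∀ᶠ e : (ι → ℂ) × ℂ × ℂ in residual _, ∀ i j, ∀ n l : ℤ,
      br (e.1 i + e.1 j + (n * e.2.1 + l * e.2.2)) ≠ 0 := by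
    simp only [Filter.eventually_all, eventually_countable_forall]
    intro i j n l
    refine hb.residual_ne (by fun_prop) (Pi.single i 1, 0, 0)
      (c := 1 + if j = i then 1 else 0) (by split_ifs <;> norm_num) fun e t => ?_
    simp only [Prod.snd_add, Prod.fst_add, Prod.smul_snd, Prod.smul_fst, smul_eq_mul,
      Pi.add_apply, Pi.smul_apply, Pi.single_eq_same, Pi.single_apply]
    ring
  refine dense_of_mem_residual ?_
  filter_upwards [hlat, hsub, hadd] with e h₁ h₂ h₃ using ⟨h₁, h₂, h₃⟩

end density

section continuity

variable {br : ℂ → ℂ} {X : Type*} [TopologicalSpace X]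

lemma continuousAt_sfac (hc : Continuous br) {a u : X → ℂ} (ha : Continuous a)
    (hu : Continuous u) (n : ℕ) (e : X) : ContinuousAt (fun t => sfac br (a t) (u t) n) e := by
  simp only [sfac_natCast]
  fun_prop

lemma continuousAt_sfac_div (hc : Continuous br) {a u v : X → ℂ} (ha : Continuous a)
    (hu : Continuous u) (hv : Continuous v) {n : ℤ} {e : X}
    (h : if 0 ≤ n then sfac br (a e) (v e) n ≠ 0 else sfac br (a e) (u e) n ≠ 0) :
    ContinuousAt (fun t => sfac br (a t) (u t) n / sfac br (a t) (v t) n) e := by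
  split_ifs at h with hn
  · lift n to ℕ using hn
    exact (continuousAt_sfac hc ha hu n e).div (continuousAt_sfac hc ha hv n e) h
  · obtain ⟨p, rfl⟩ : ∃ p : ℕ, n = -(p : ℤ) := ⟨(-n).toNat, by omega⟩
    simp only [sfac_neg_natCast, div_inv_eq_mul] at h ⊢
    exact (ContinuousAt.inv₀ (by fun_prop) (fun h0 => h (by rw [h0, inv_zero]))).mul (by fun_prop)

lemma continuousAt_Tterm (hc : Continuous br) {m r : ℕ} {δ κ : X → ℂ} {x z : X → Fin m → ℂ}
    {y : X → Fin r → ℂ} (hδ : Continuous δ) (hκ : Continuous κ)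
    (hx : ∀ i, Continuous fun t => x t i) (hy : ∀ i, Continuous fun t => y t i)
    (hz : ∀ i, Continuous fun t => z t i) {μ : Fin m → ℕ} {P : Finset (Fin r)} {e : X}
    (h : TDenomNZ br (δ e) (κ e) μ P (x e) (y e) (z e)) :
    ContinuousAt (fun t => Tterm br (δ t) (κ t) μ P (x t) (y t) (z t)) e := by
  obtain ⟨h₁, h₂, h₃, h₄⟩ := h
  refine ((tendsto_finsetProd _ fun i hi => tendsto_finsetProd _ fun j hj => ?_).mul
    (tendsto_finsetProd _ fun i _ => tendsto_finsetProd _ fun j _ => ?_)).mul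
    (tendsto_finsetProd _ fun i _ => (tendsto_finsetProd _ fun j hj => ?_).mul
      (tendsto_finsetProd _ fun j hj => ?_))
  · refine ContinuousAt.div (by fun_prop) (by fun_prop) (mul_ne_zero ?_ ?_)
    · exact (h₁ i hi j hj).1
    · exact (h₁ i hi j hj).2
  · have hu : Continuous fun t => x t i - x t j + δ t := by fun_prop
    have hv : Continuous fun t => x t i - x t j + κ t := by fun_prop
    have hs : Continuous fun t => x t i + z t j := by fun_prop
    have hw : Continuous fun t => x t i + z t j + δ t - κ t := by fun_prop
    have hq := continuousAt_sfac_div hc hδ hu hv (n := (μ i : ℤ) - (μ j : ℤ)) (e := e) (h₂ i j).1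
    have hnum := (continuousAt_sfac hc hδ hv (μ i) e).mul (continuousAt_sfac hc hδ hs (μ i) e)
    have hden := (continuousAt_sfac hc hδ hu (μ i) e).mul (continuousAt_sfac hc hδ hw (μ i) e)
    exact hq.mul (hnum.div hden (mul_ne_zero (h₂ i j).2.1 (h₂ i j).2.2))
  · refine ContinuousAt.div (by fun_prop) (by fun_prop) (mul_ne_zero ?_ ?_)
    · exact (h₃ i j hj).1
    · exact (h₃ i j hj).2
  · refine ContinuousAt.div (by fun_prop) (by fun_prop) (mul_ne_zero ?_ ?_)
    · exact (h₄ i j hj).1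
    · exact (h₄ i j hj).2

end continuity

/-- Transformation identity (generalizing Langer–Schlosser–Warnaar):
`T_k(x; y; z) = T_k(z; ŷ; x)` with `ŷ_j = -y_j - δ`, at every admissible point. -/
theorem Tsum_transformation
    (br : ℂ → ℂ) (hodd : ∀ z : ℂ, br (-z) = -br z)
    (hent : Differentiable ℂ br) (hnz : br ≠ 0)
    (hW : ∀ a b c d : ℂ,
      br (a + b) * br (a - b) * br (c + d) * br (c - d)
        + br (a + d) * br (a - d) * br (b + c) * br (b - c)
        = br (a + c) * br (a - c) * br (b + d) * br (b - d))
    (δ κ : ℂ)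
    (hδ : ∀ n : ℕ, 1 ≤ n → br ((n : ℂ) * δ) ≠ 0)
    (hκ : ∀ n : ℕ, 1 ≤ n → br ((n : ℂ) * κ) ≠ 0)
    (m r k : ℕ) (x z : Fin m → ℂ) (y : Fin r → ℂ)
    (h1 : ∀ p ∈ TIdx m r k, TDenomNZ br δ κ p.1 p.2 x y z)
    (h2 : ∀ p ∈ TIdx m r k, TDenomNZ br δ κ p.1 p.2 z (fun j => -y j - δ) x) :
    Tsum br δ κ m r k x y z = Tsum br δ κ m r k z (fun j => -y j - δ) x := by
  have hb : IsBracket br := ⟨hodd, hent, hnz, hW⟩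
  have hc := hb.continuous
  have hd := hb.dense_bracketGeneric (Fin m ⊕ Fin m ⊕ Fin r)
    ((Sum.elim x (Sum.elim z y), δ, κ) : (Fin m ⊕ Fin m ⊕ Fin r → ℂ) × ℂ × ℂ)
  rw [mem_closure_iff_nhdsWithin_neBot] at hd
  have hL : ContinuousAt (fun e : (Fin m ⊕ Fin m ⊕ Fin r → ℂ) × ℂ × ℂ =>
      Tsum br e.2.1 e.2.2 m r k (fun i => e.1 (.inl i)) (fun j => e.1 (.inr (.inr j)))
        fun i => e.1 (.inr (.inl i))) (Sum.elim x (Sum.elim z y), δ, κ) :=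
    tendsto_finsetSum _ fun p hp => continuousAt_Tterm hc (by fun_prop) (by fun_prop)
      (by fun_prop) (by fun_prop) (by fun_prop) (h1 p hp)
  have hR : ContinuousAt (fun e : (Fin m ⊕ Fin m ⊕ Fin r → ℂ) × ℂ × ℂ =>
      Tsum br e.2.1 e.2.2 m r k (fun i => e.1 (.inr (.inl i)))
        (fun j => -e.1 (.inr (.inr j)) - e.2.1) fun i => e.1 (.inl i))
      (Sum.elim x (Sum.elim z y), δ, κ) :=
    tendsto_finsetSum _ fun p hp => continuousAt_Tterm hc (by fun_prop) (by fun_prop)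
      (by fun_prop) (by fun_prop) (by fun_prop) (h2 p hp)
  have hL' := hL.tendsto.mono_left
    (nhdsWithin_le_nhds (s := {e | BracketGeneric br e.2.1 e.2.2 e.1}))
  have hR' := hR.tendsto.mono_left
    (nhdsWithin_le_nhds (s := {e | BracketGeneric br e.2.1 e.2.2 e.1}))
  refine tendsto_nhds_unique hL' (hR'.congr' ?_)
  filter_upwards [self_mem_nhdsWithin] with e he
  refine (BracketGeneric.Tsum_eq hb ?_ k).symm
  convert he using 1
  ext (i | i | i) <;> rfl
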